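/- arXiv:0909.5541 — 3 statements merged into one kernel-verified Lean document; each statement's English description precedes it below -/
import Mathlib

section
/- Let α_2, β_2, β_3, γ_1 : ℕ → ℚ be given by the closed forms α_2(n) = (7·17/(2^4·3^3))·4^n − 2/3^3 − (1/(2^2·3^2))·δ_{n,1}, β_2(n) = (7·17/(2^5·3^2))·4^n − 7/(2^2·3^2) + (1/(2^3·3))·δ_{n,1}, β_3(n) = (7·17/(2^4·3^2))·4^n − 47/(2^2·3^2), γ_1(n) = (7·17/(2^6·3))·4^n − 5/(2^2·3) − (1/2^4)·δ_{n,1}. Let α_3, β_4, γ_2 : ℕ → ℚ satisfy α_3(1) = 0, β_4(1) = 1/2, γ_2(1) = 3 and, for all n ≥ 1: α_3(n+1) = 2[α_2(n)β_2(n) + β_2(n) + β_4(n)]; β_4(n+1) = 3/4 + β_2(n)(2 + β_2(n)/3) + β_3(n)(2 + (2/3)β_2(n) + β_3(n)) + α_2(n)(3/4 + β_2(n) + β_3(n) + γ_1(n)/3) + 2β_4(n) + (1/3)(γ_1(n) + γ_2(n)); γ_2(n+1) = 9/4 + β_2(n)(3 + β_2(n)) + β_3(n)(6 + 2β_2(n)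 + 3β_3(n)) + γ_1(n)(4 + α_2(n) + (4/3)β_2(n) + (4/3)β_3(n)) + 3β_4(n) + 2γ_2(n). Then for all n ≥ 2, α_3(n) = (5^2·7^2·17^2/(2^12·3^5·13))·16^n − (7·17/(2^4·3^5))·4^n + (11·257/(2^3·3^5·13))·3^n − 1009/(2^3·3^5) − (1/(2^4·3^3))·δ_{n,2}, where δ is the Kronecker delta. -/
/-- closed form for the ratio sequence `α₃`, given the closed-form
inputs `α₂, β₂, β₃, γ₁` and the recursion for `α₃, β₄, γ₂`. -/
theorem alpha3_closed_form (α₂ β₂ β₃ γ₁ α₃ β₄ γ₂ : ℕ → ℚ)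
    (hα₂ : ∀ n : ℕ, α₂ n = (7 * 17 / (2 ^ 4 * 3 ^ 3)) * 4 ^ n - 2 / 3 ^ 3 -
      (if n = 1 then 1 / (2 ^ 2 * 3 ^ 2) else 0))
    (hβ₂ : ∀ n : ℕ, β₂ n = (7 * 17 / (2 ^ 5 * 3 ^ 2)) * 4 ^ n - 7 / (2 ^ 2 * 3 ^ 2) +
      (if n = 1 then 1 / (2 ^ 3 * 3) else 0))
    (hβ₃ : ∀ n : ℕ, β₃ n = (7 * 17 / (2 ^ 4 * 3 ^ 2)) * 4 ^ n - 47 / (2 ^ 2 * 3 ^ 2))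
    (hγ₁ : ∀ n : ℕ, γ₁ n = (7 * 17 / (2 ^ 6 * 3)) * 4 ^ n - 5 / (2 ^ 2 * 3) -
      (if n = 1 then 1 / 2 ^ 4 else 0))
    (hα₃1 : α₃ 1 = 0) (hβ₄1 : β₄ 1 = 1 / 2) (hγ₂1 : γ₂ 1 = 3)
    (rα₃ : ∀ n : ℕ, 1 ≤ n →
      α₃ (n + 1) = 2 * (α₂ n * β₂ n + β₂ n + β₄ n))
    (rβ₄ : ∀ n : ℕ, 1 ≤ n →
      β₄ (n + 1) = 3 / 4 + β₂ n * (2 + β₂ n / 3) +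
        β₃ n * (2 + (2 / 3) * β₂ n + β₃ n) +
        α₂ n * (3 / 4 + β₂ n + β₃ n + γ₁ n / 3) +
        2 * β₄ n + (1 / 3) * (γ₁ n + γ₂ n))
    (rγ₂ : ∀ n : ℕ, 1 ≤ n →
      γ₂ (n + 1) = 9 / 4 + β₂ n * (3 + β₂ n) +
        β₃ n * (6 + 2 * β₂ n + 3 * β₃ n) +
        γ₁ n * (4 + α₂ n + (4 / 3) * β₂ n + (4 / 3) * β₃ n) +
        3 * β₄ n + 2 * γ₂ n) :
    ∀ n : ℕ, 2 ≤ n →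
      α₃ n = (5 ^ 2 * 7 ^ 2 * 17 ^ 2 / (2 ^ 12 * 3 ^ 5 * 13)) * 16 ^ n -
        (7 * 17 / (2 ^ 4 * 3 ^ 5)) * 4 ^ n +
        (11 * 257 / (2 ^ 3 * 3 ^ 5 * 13)) * 3 ^ n -
        1009 / (2 ^ 3 * 3 ^ 5) -
        (if n = 2 then 1 / (2 ^ 4 * 3 ^ 3) else 0) := by
  have hβγ : ∀ n : ℕ, 2 ≤ n →
      β₄ n = 14161 / 134784 * 16 ^ n - 2023 / 5184 * 4 ^ n + 2827 / 16848 * 3 ^ n - 103 / 1296 ∧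
      γ₂ n = 14161 / 44928 * 16 ^ n - 2261 / 1728 * 4 ^ n + 2827 / 5616 * 3 ^ n + 223 / 144 := by
    intro n hn
    induction n, hn using Nat.le_induction with
    | base =>
      rw [show 2 = 1 + 1 from rfl, rβ₄ 1 le_rfl, rγ₂ 1 le_rfl, hα₂, hβ₂, hβ₃, hγ₁, hβ₄1, hγ₂1]
      norm_num
    | succ n hn ih =>
      have h1 : n ≠ 1 := by lia
      have h16 : (16 : ℚ) ^ n = (4 ^ n) ^ 2 := by rw [← pow_mul, mul_comm, pow_mul]; norm_num
      rw [rβ₄ n (by lia), rγ₂ n (by lia), ih.1, ih.2, hα₂, hβ₂, hβ₃, hγ₁]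
      simp only [h1, if_false, pow_succ _ n, h16]
      constructor <;> ring
  intro n hn
  obtain ⟨m, rfl⟩ : ∃ m, n = m + 1 := ⟨n - 1, by lia⟩
  obtain rfl | hm : m = 1 ∨ 2 ≤ m := by lia
  · rw [rα₃ 1 le_rfl, hα₂, hβ₂, hβ₄1]
    norm_num
  · have h1 : m ≠ 1 := by lia
    have h2 : m + 1 ≠ 2 := by lia
    have h16 : (16 : ℚ) ^ m = (4 ^ m) ^ 2 := by rw [← pow_mul, mul_comm, pow_mul]; norm_num
    rw [rα₃ m (by lia), (hβγ m hm).1, hα₂, hβ₂]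
    simp only [h1, h2, if_false, pow_succ _ m, h16]
    ring
end

section
/- For every integer n ≥ 2, the number of Hamiltonian cycles of SG(n) equals the cube of the number of Hamiltonian paths of SG(n−1) whose two end vertices are o and a_{n−1}: HC(n) = f_1(n−1)³. -/
open scoped Classical
open Filter Topology

noncomputable section

namespace SierpinskiGasket

/-- √3 -/
def sq3 : ℝ := Real.sqrt 3

/-- the origin, leftmost outmost vertex of every `SG n` -/
def o : ℝ × ℝ := (0, 0)

/-- `a m = (2^m, 0)`, the rightmost vertex of `SG m` (also a translation vector). -/
def a (m : ℕ) : ℝ × ℝ := ((2:ℝ) ^ m, 0)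

/-- `b m = (2^(m-1), 2^(m-1)·√3)`, the topmost vertex of `SG m`. -/
def b (m : ℕ) : ℝ × ℝ := ((2:ℝ) ^ m / 2, (2:ℝ) ^ m / 2 * sq3)

/-- `c m = (3·2^(m-1), 2^(m-1)·√3)`. -/
def c (m : ℕ) : ℝ × ℝ := (3 * (2:ℝ) ^ m / 2, (2:ℝ) ^ m / 2 * sq3)

/-- vertex set of `SG n` -/
def V : ℕ → Set (ℝ × ℝ)
  | 0 => {o, a 0, b 0}
  | n + 1 => V n ∪ ((· + a n) '' V n) ∪ ((· + b n) '' V n)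

/-- edge set of `SG n` -/
def E : ℕ → Set (Sym2 (ℝ × ℝ))
  | 0 => {s(o, a 0), s(o, b 0), s(a 0, b 0)}
  | n + 1 => E n ∪ (Sym2.map (· + a n) '' E n) ∪ (Sym2.map (· + b n) '' E n)

/-- `SG n` as a simple graph on `ℝ × ℝ` -/
def G (n : ℕ) : SimpleGraph (ℝ × ℝ) := SimpleGraph.fromEdgeSet (E n)

/-- a Hamiltonian path of `SG n`: a path visiting every vertex of `SG n` exactly once -/
def IsHamPath (n : ℕ) {u v : ℝ × ℝ} (p : (G n).Walk u v) : Prop :=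
  p.IsPath ∧ ∀ x, x ∈ p.support ↔ x ∈ V n

/-- a Hamiltonian cycle of `SG n` -/
def IsHamCycle (n : ℕ) {u : ℝ × ℝ} (p : (G n).Walk u u) : Prop :=
  p.IsCycle ∧ ∀ x, x ∈ p.support ↔ x ∈ V n

/-- `f n u v`: the number of Hamiltonian paths of `SG n` with end-vertex set `{u, v}`
(for `u ≠ v`, such unordered paths correspond bijectively to walks from `u` to `v`). -/
def f (n : ℕ) (u v : ℝ × ℝ) : ℕ := Nat.card {p : (G n).Walk u v // IsHamPath n p}

/-- `f1 n`: the number of Hamiltonian paths of `SG n` with end-vertex set `{o, a n}` -/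
def f1 (n : ℕ) : ℕ := f n o (a n)

/-- the number of Hamiltonian cycles of `SG n`, counted up to starting vertex and
orientation: every Hamiltonian cycle passes through `o` and has exactly two
representatives as a closed walk based at `o`. -/
def HC (n : ℕ) : ℕ := Nat.card {p : (G n).Walk o o // IsHamCycle n p} / 2

/-- the number of Hamiltonian paths of `SG n` having `o` as one of their end vertices -/
def H0 (n : ℕ) : ℕ := ∑ᶠ x ∈ {x : ℝ × ℝ | x ≠ o}, f n o x

/-- the total number of Hamiltonian paths of `SG n` (a path and its reversal
are the same unordered object, whence the division by `2`). -/
def H (n : ℕ) : ℕ := (∑ᶠ u : ℝ × ℝ, ∑ᶠ v : ℝ × ℝ, f n u v) / 2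

/-- the distribution ratio `F(n,x) = f(n,x)/f1(n)` -/
def F (n : ℕ) (x : ℝ × ℝ) : ℝ := (f n o x : ℝ) / (f1 n : ℝ)

/-- `SG n` with the vertex `b n` (and its incident edges) deleted -/
def Gd (n : ℕ) : SimpleGraph (ℝ × ℝ) := SimpleGraph.fromEdgeSet {e ∈ E n | b n ∉ e}

/-- Hamiltonian path of `SG n - b n` -/
def IsHamPathD (n : ℕ) {u v : ℝ × ℝ} (p : (Gd n).Walk u v) : Prop :=
  p.IsPath ∧ ∀ x, x ∈ p.support ↔ (x ∈ V n ∧ x ≠ b n)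

/-- `g2 n x`: the number of Hamiltonian paths of `SG n - b n` with end-vertex set `{o, x}` -/
def g2 (n : ℕ) (x : ℝ × ℝ) : ℕ := Nat.card {p : (Gd n).Walk o x // IsHamPathD n p}

/-- `g1 n`: the number of Hamiltonian paths of `SG n - b n` with end-vertex set `{o, a n}` -/
def g1 (n : ℕ) : ℕ := g2 n (a n)

/-- the distribution ratio `G₂(n,x) = g₂(n,x)/g₁(n)` -/
def G2 (n : ℕ) (x : ℝ × ℝ) : ℝ := (g2 n x : ℝ) / (g1 n : ℝ)

/-- mid-side vertex `a_{m,1} = (3·2^(m-1), 0)` -/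
def a1 (m : ℕ) : ℝ × ℝ := (3 * (2:ℝ) ^ m / 2, 0)

/-- mid-side vertex `b_{m,1} = (5·2^(m-2), 2^(m-2)·√3)` -/
def b1 (m : ℕ) : ℝ × ℝ := (5 * (2:ℝ) ^ m / 4, (2:ℝ) ^ m / 4 * sq3)

/-- mid-side vertex `c_{m,1} = (7·2^(m-2), 2^(m-2)·√3)` -/
def c1 (m : ℕ) : ℝ × ℝ := (7 * (2:ℝ) ^ m / 4, (2:ℝ) ^ m / 4 * sq3)

/-- mid-side vertex `a_{m,2} = (2^m, 2^(m-1)·√3)` -/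
def a2 (m : ℕ) : ℝ × ℝ := ((2:ℝ) ^ m, (2:ℝ) ^ m / 2 * sq3)

/-- mid-side vertex `b_{m,2} = (3·2^(m-2), 3·2^(m-2)·√3)` -/
def b2 (m : ℕ) : ℝ × ℝ := (3 * (2:ℝ) ^ m / 4, 3 * (2:ℝ) ^ m / 4 * sq3)

/-- mid-side vertex `c_{m,2} = (5·2^(m-2), 3·2^(m-2)·√3)` -/
def c2 (m : ℕ) : ℝ × ℝ := (5 * (2:ℝ) ^ m / 4, 3 * (2:ℝ) ^ m / 4 * sq3)

/-- exceptional vertex `a* = (2^(n-1), (2^(n-1)-1)·√3)` -/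
def astar (n : ℕ) : ℝ × ℝ := ((2:ℝ) ^ n / 2, ((2:ℝ) ^ n / 2 - 1) * sq3)

/-- exceptional vertex `b* = (2^(n-1) - 1/2, (2^n-1)·√3/2)` -/
def bstar (n : ℕ) : ℝ × ℝ := ((2:ℝ) ^ n / 2 - 1/2, ((2:ℝ) ^ n - 1) * sq3 / 2)

/-- exceptional vertex `c* = (2^(n-1) + 1/2, (2^n-1)·√3/2)` -/
def cstar (n : ℕ) : ℝ × ℝ := ((2:ℝ) ^ n / 2 + 1/2, ((2:ℝ) ^ n - 1) * sq3 / 2)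

/-- the Euclidean norm on `ℝ × ℝ` -/
def enorm (x : ℝ × ℝ) : ℝ := Real.sqrt (x.1 ^ 2 + x.2 ^ 2)

/-- the set `C n` of corner vertices of `SG n` -/
def C (n : ℕ) : Finset (ℝ × ℝ) :=
  ((Finset.range (n + 1)).image a) ∪ ((Finset.range (n + 1)).image b) ∪
    ((Finset.range n).image c)

/-- the mean `ℓ` displacement over the corner vertices -/
def xi' (n : ℕ) (ℓ : ℝ) : ℝ :=
  (∑ x ∈ C n, enorm x ^ ℓ * F n x) / (∑ x ∈ C n, F n x)

/-- `p(n,x)`: the probability that a Hamiltonian path with one end at `o`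
has its other end at `x` -/
def p (n : ℕ) (x : ℝ × ℝ) : ℝ := (f n o x : ℝ) / (H0 n : ℝ)

/-- the mean `ℓ` displacement of Hamiltonian paths on `SG n` with one end at `o` -/
def xi (n : ℕ) (ℓ : ℝ) : ℝ :=
  ∑ᶠ x ∈ {x : ℝ × ℝ | x ∈ V n ∧ x ≠ o}, enorm x ^ ℓ * p n x

/-- the partition function of Hamiltonian paths on `SG n` -/
def Z (n : ℕ) (β : ℝ) : ℝ := (H n : ℝ) * Real.exp (-(β * ((3 ^ (n + 1) + 1) / 2)))

/-- The interiors of the walks from `u` to `v` along the relation `R` that visit, between their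
end points, every element of `T` exactly once and nothing else. For `u = v` these are the
Hamiltonian cycles of `insert u T` based at `u`. -/
def interiors {α : Type*} (R : α → α → Prop) (T : Set α) (u v : α) : Set (List α) :=
  {m | (u :: (m ++ [v])).IsChain R ∧ m.Nodup ∧ ∀ x, x ∈ m ↔ x ∈ T}

/-- The pairs of interiors of a walk from `u` to `w` and a walk from `w` to `v` that together
visit every element of `T` exactly once. -/
def splitInteriors {α : Type*} (R : α → α → Prop) (T : Set α) (u w v : α) :
    Set (List α × List α) :=
  {q | (u :: (q.1 ++ [w])).IsChain R ∧ (w :: (q.2 ++ [v])).IsChain R ∧ (q.1 ++ q.2).Nodup ∧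
    ∀ x, x ∈ q.1 ++ q.2 ↔ x ∈ T}

section Interiors

variable {α β : Type*} {R : α → α → Prop} {T T₁ T₂ : Set α} {u v w : α}

theorem finite_nodup_lists (hT : T.Finite) : {m : List α | m.Nodup ∧ ∀ x ∈ m, x ∈ T}.Finite := by
  have : Finite T := hT
  have := Fintype.ofFinite T
  refine (Set.finite_range
    (fun l : {l : List T // l.Nodup} => l.1.map Subtype.val)).subset ?_
  rintro m ⟨hm, hmem⟩
  lift m to List T using hmem
  exact ⟨⟨m, hm.of_map _⟩, rfl⟩

theorem interiors_finite (hT : T.Finite) : (interiors R T u v).Finite :=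
  (finite_nodup_lists hT).subset fun _ h => ⟨h.2.1, fun x hx => (h.2.2 x).1 hx⟩

theorem ncard_interiors_insert (hw : w ∉ T) :
    (interiors R (insert w T) u v).ncard = (splitInteriors R T u w v).ncard := by
  have himg : interiors R (insert w T) u v =
      (fun q : List α × List α => q.1 ++ w :: q.2) '' splitInteriors R T u w v := by
    ext m
    constructor
    · rintro ⟨hc, hn, hm⟩
      obtain ⟨m₁, m₂, rfl⟩ := List.append_of_mem ((hm w).2 (Set.mem_insert w T))
      rw [List.append_assoc, List.cons_append, List.isChain_cons_split] at hc
      refine ⟨(m₁, m₂), ⟨hc.1, hc.2, by grind, fun x => ?_⟩, rfl⟩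
      have := hm x
      have hw' : w ∉ m₁ ++ m₂ := by grind
      by_cases hx : x = w
      · subst hx
        simp only [hw', hw]
      · simpa [hx] using this
    · rintro ⟨⟨m₁, m₂⟩, ⟨hc₁, hc₂, hn, hm⟩, rfl⟩
      refine ⟨?_, ?_, fun x => ?_⟩
      · rw [List.append_assoc, List.cons_append, List.isChain_cons_split]
        exact ⟨hc₁, hc₂⟩
      · have := (hm w).not.2 hw
        grind
      · have := hm x
        simp only [List.mem_append, List.mem_cons, Set.mem_insert_iff] at this ⊢
        tauto
  rw [himg, Set.InjOn.ncard_image]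
  rintro ⟨m₁, m₂⟩ ⟨-, -, -, hm⟩ ⟨m₁', m₂'⟩ ⟨-, -, -, hm'⟩ heq
  have h := (hm w).not.2 hw
  have h' := (hm' w).not.2 hw
  simp only at heq h h'
  rw [List.append_cons_inj_of_notMem] at heq
  · grind
  · grind
  · grind

theorem ncard_interiors_rotate (hu : u ∉ T) (hw : w ∉ T) :
    (interiors R (insert w T) u u).ncard = (interiors R (insert u T) w w).ncard := by
  rw [ncard_interiors_insert hw, ncard_interiors_insert hu]
  refine Set.ncard_congr (fun q _ => q.swap) ?_ (fun _ _ _ _ h => Prod.swap_injective h) ?_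
  all_goals
    rintro ⟨m₁, m₂⟩ ⟨h₁, h₂, hn, hm⟩
    have hm' : ∀ x, x ∈ m₂ ++ m₁ ↔ x ∈ T := fun x => by rw [← hm x]; simp [or_comm]
  · exact ⟨h₂, h₁, List.nodup_append_comm.1 hn, hm'⟩
  · exact ⟨(m₂, m₁), ⟨h₂, h₁, List.nodup_append_comm.1 hn, hm'⟩, rfl⟩

theorem ncard_interiors_reverse (hR : ∀ x y, R x y → R y x) :
    (interiors R T u v).ncard = (interiors R T v u).ncard := by
  have key : ∀ {u v : α} {m : List α}, m ∈ interiors R T u v → m.reverse ∈ interiors R T v u := by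
    rintro u v m ⟨hc, hn, hm⟩
    refine ⟨?_, List.nodup_reverse.2 hn, fun x => by rw [List.mem_reverse, hm]⟩
    have : v :: (m.reverse ++ [u]) = (u :: (m ++ [v])).reverse := by simp
    rw [this, List.isChain_reverse]
    exact hc.imp fun _ _ h => hR _ _ h
  exact Set.ncard_congr (fun m _ => m.reverse) (fun _ => key)
    (fun _ _ _ _ h => List.reverse_injective h)
    (fun m hm => ⟨m.reverse, key hm, m.reverse_reverse⟩)

theorem ncard_interiors_image {R' : β → β → Prop} {S : Set α} {φ : α → β}
    (hφ : Function.Injective φ) (hR : ∀ x ∈ S, ∀ y ∈ S, R x y ↔ R' (φ x) (φ y))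
    (hT : T ⊆ S) (hu : u ∈ S) (hv : v ∈ S) :
    (interiors R' (φ '' T) (φ u) (φ v)).ncard = (interiors R T u v).ncard := by
  have hmem : ∀ m : List α, (∀ x, x ∈ m.map φ ↔ x ∈ φ '' T) ↔ ∀ x, x ∈ m ↔ x ∈ T := by
    intro m
    refine ⟨fun h x => ?_, fun h x => by simp [h]⟩
    simpa [hφ.mem_set_image, List.mem_map_of_injective hφ] using h (φ x)
  have hchain : ∀ m : List α, (∀ x, x ∈ m ↔ x ∈ T) →
      ((φ u :: (m.map φ ++ [φ v])).IsChain R' ↔ (u :: (m ++ [v])).IsChain R) := by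
    intro m hm
    have : φ u :: (m.map φ ++ [φ v]) = (u :: (m ++ [v])).map φ := by simp
    rw [this, List.isChain_map]
    have hS : ∀ x ∈ u :: (m ++ [v]), x ∈ S := by
      intro x hx
      simp only [List.mem_cons, List.mem_append, List.not_mem_nil, or_false, hm] at hx
      rcases hx with rfl | hx | rfl
      exacts [hu, hT hx, hv]
    exact ⟨fun h => h.imp_of_mem_imp fun x y hx hy => (hR x (hS x hx) y (hS y hy)).2,
      fun h => h.imp_of_mem_imp fun x y hx hy => (hR x (hS x hx) y (hS y hy)).1⟩
  rw [← Set.ncard_image_of_injective _ (List.map_injective_iff.2 hφ)]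
  congr 1
  ext m'
  constructor
  · rintro ⟨hc, hn, hm⟩
    have : m' ∈ Set.range (List.map φ) := by
      rw [Set.range_list_map]
      exact fun x hx => Set.image_subset_range _ _ ((hm x).1 hx)
    obtain ⟨m, rfl⟩ := this
    rw [hmem] at hm
    exact ⟨m, ⟨(hchain m hm).1 hc, hn.of_map _, hm⟩, rfl⟩
  · rintro ⟨m, ⟨hc, hn, hm⟩, rfl⟩
    exact ⟨(hchain m hm).2 hc, hn.map hφ, (hmem m).2 hm⟩

/-- A chain in `T₁ ∪ T₂` stays on one side if `R` does not relate the two sides. -/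
theorem isChain_one_sided (hR : ∀ x ∈ T₁, ∀ y ∈ T₂, ¬ R x y ∧ ¬ R y x) :
    ∀ {m : List α}, m.IsChain R → (∀ x ∈ m, x ∈ T₁ ∨ x ∈ T₂) →
      (∀ x ∈ m, x ∈ T₁) ∨ ∀ x ∈ m, x ∈ T₂
  | [], _, _ => by simp
  | [x], _, hm => by simpa using hm
  | x :: y :: m, hc, hm => by
    rw [List.isChain_cons_cons] at hc
    have ih := isChain_one_sided hR hc.2 fun z hz => hm z (List.mem_cons_of_mem _ hz)
    have hx := hm x List.mem_cons_self
    have hxy := hR x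
    have hyx := hR y
    grind

theorem splitInteriors_union (hR : ∀ x ∈ T₁, ∀ y ∈ T₂, ¬ R x y ∧ ¬ R y x)
    (hd : Disjoint T₁ T₂) (h₁ : T₁.Nonempty) (h₂ : T₂.Nonempty) :
    splitInteriors R (T₁ ∪ T₂) u w v =
      interiors R T₁ u w ×ˢ interiors R T₂ w v ∪ interiors R T₂ u w ×ˢ interiors R T₁ w v := by
  have hd' : ∀ x, x ∈ T₁ → x ∉ T₂ := fun x hx hx' => Set.disjoint_left.1 hd hx hx'
  ext ⟨m₁, m₂⟩
  constructor
  · rintro ⟨hc₁, hc₂, hn, hm⟩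
    simp only [List.mem_append, Set.mem_union] at hm
    have side : ∀ {u v : α} {m : List α}, (u :: (m ++ [v])).IsChain R →
        (∀ x ∈ m, x ∈ T₁ ∨ x ∈ T₂) → (∀ x ∈ m, x ∈ T₁) ∨ ∀ x ∈ m, x ∈ T₂ := by
      intro u v m hc
      exact isChain_one_sided hR (hc.infix ⟨[u], [v], by simp⟩)
    have s₁ := side hc₁ fun x hx => (hm x).1 (Or.inl hx)
    have s₂ := side hc₂ fun x hx => (hm x).1 (Or.inr hx)
    obtain ⟨n₁, n₂, -⟩ := List.nodup_append.1 hn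
    obtain ⟨x₁, hx₁⟩ := h₁
    obtain ⟨x₂, hx₂⟩ := h₂
    rcases s₁ with s₁ | s₁ <;> rcases s₂ with s₂ | s₂
    · grind
    · exact Or.inl ⟨⟨hc₁, n₁, by grind⟩, ⟨hc₂, n₂, by grind⟩⟩
    · exact Or.inr ⟨⟨hc₁, n₁, by grind⟩, ⟨hc₂, n₂, by grind⟩⟩
    · grind
  · rintro (⟨⟨hc₁, n₁, hm₁⟩, ⟨hc₂, n₂, hm₂⟩⟩ | ⟨⟨hc₁, n₁, hm₁⟩, ⟨hc₂, n₂, hm₂⟩⟩) <;>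
      refine ⟨hc₁, hc₂, List.nodup_append.2 ⟨n₁, n₂, ?_⟩, fun x => ?_⟩ <;> grind

theorem ncard_interiors_insert_union (hfin₁ : T₁.Finite) (hfin₂ : T₂.Finite)
    (hR : ∀ x ∈ T₁, ∀ y ∈ T₂, ¬ R x y ∧ ¬ R y x) (hd : Disjoint T₁ T₂)
    (h₁ : T₁.Nonempty) (h₂ : T₂.Nonempty) (hw₁ : w ∉ T₁) (hw₂ : w ∉ T₂) :
    (interiors R (insert w (T₁ ∪ T₂)) u v).ncard =
      (interiors R T₁ u w).ncard * (interiors R T₂ w v).ncard +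
        (interiors R T₂ u w).ncard * (interiors R T₁ w v).ncard := by
  rw [ncard_interiors_insert (by simp [hw₁, hw₂]), splitInteriors_union hR hd h₁ h₂,
    Set.ncard_union_eq _ ((interiors_finite hfin₁).prod (interiors_finite hfin₂))
      ((interiors_finite hfin₂).prod (interiors_finite hfin₁)), Set.ncard_prod, Set.ncard_prod]
  rw [Set.disjoint_left]
  rintro ⟨m₁, m₂⟩ ⟨⟨-, -, hm₁⟩, -⟩ ⟨⟨-, -, hm₂⟩, -⟩
  obtain ⟨x, hx⟩ := h₁
  exact Set.disjoint_left.1 hd hx ((hm₂ x).1 ((hm₁ x).2 hx))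

theorem interiors_eq_empty (hT : T.Nonempty) (hu : ∀ x ∈ T, ¬ R u x) :
    interiors R T u v = ∅ := by
  refine Set.eq_empty_of_forall_notMem ?_
  rintro (_ | ⟨x, m⟩) ⟨hc, -, hm⟩
  · obtain ⟨x, hx⟩ := hT
    simpa using (hm x).2 hx
  · exact hu x ((hm x).1 List.mem_cons_self) (List.isChain_cons_cons.1 hc).1

/-- If three pieces `A`, `B` and `C` are glued pairwise at the points `a`, `b` and `c`, then a
Hamiltonian cycle runs through each piece along a Hamiltonian path between its gluing points. -/
theorem ncard_interiors_three_pieces {A B C : Set α} {o a b c a' b' : α}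
    (hfinA : A.Finite) (hfinB : B.Finite) (hfinC : C.Finite) (hsymm : ∀ x y, R x y → R y x)
    (hAB : ∀ x ∈ A, x ∈ B → x = a) (hAC : ∀ x ∈ A, x ∈ C → x = b) (hBC : ∀ x ∈ B, x ∈ C → x = c)
    (hR : ∀ x y, R x y → x ∈ A ∧ y ∈ A ∨ x ∈ B ∧ y ∈ B ∨ x ∈ C ∧ y ∈ C)
    (hoA : o ∈ A) (haA : a ∈ A) (hbA : b ∈ A) (haB : a ∈ B) (hcB : c ∈ B) (hbC : b ∈ C)
    (haB' : a' ∈ B) (hbC' : b' ∈ C) (hoa : o ≠ a) (hob : o ≠ b) (hab : a ≠ b)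
    (hac : a ≠ c) (hbc : b ≠ c) (haa' : a' ≠ a) (hca' : a' ≠ c) (hbb' : b' ≠ b) (hcb' : b' ≠ c) :
    (interiors R ((A ∪ B ∪ C) \ {o}) o o).ncard =
      2 * ((interiors R (A \ {a, b}) a b).ncard * (interiors R (B \ {a, c}) a c).ncard *
        (interiors R (C \ {b, c}) b c).ncard) := by
  have hbB : b ∉ B := fun h => hab (hAB b hbA h).symm
  have haC : a ∉ C := fun h => hab (hAC a haA h)
  have hcA : c ∉ A := fun h => hac (hAB c h hcB).symm
  have nBC : (interiors R ((B ∪ C) \ {a, b}) b a).ncard =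
      (interiors R (C \ {b, c}) b c).ncard * (interiors R (B \ {a, c}) a c).ncard := by
    have hset : (B ∪ C) \ {a, b} = insert c ((C \ {b, c}) ∪ (B \ {a, c})) := by
      ext x
      simp only [Set.mem_sdiff, Set.mem_union, Set.mem_insert_iff, Set.mem_singleton_iff]
      grind
    have hside : ∀ x ∈ C \ {b, c}, ∀ y ∈ B \ {a, c}, ¬ R x y ∧ ¬ R y x := by
      intro x hx y hy
      simp only [Set.mem_sdiff, Set.mem_insert_iff, Set.mem_singleton_iff] at hx hy
      have h₁ := hR x y
      have h₂ := hR y x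
      grind
    have hdisj : Disjoint (C \ {b, c}) (B \ {a, c}) := by
      rw [Set.disjoint_left]
      intro x hx hy
      simp only [Set.mem_sdiff, Set.mem_insert_iff, Set.mem_singleton_iff] at hx hy
      grind
    have hb : ∀ x ∈ B \ {a, c}, ¬ R b x := by
      intro x hx h
      simp only [Set.mem_sdiff, Set.mem_insert_iff, Set.mem_singleton_iff] at hx
      have := hR _ _ h
      grind
    have hneB : (B \ {a, c}).Nonempty := ⟨a', haB', by simp [haa', hca']⟩
    rw [hset, ncard_interiors_insert_union hfinC.sdiff hfinB.sdiff hside hdisj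
        ⟨b', hbC', by simp [hbb', hcb']⟩ hneB (by simp) (by simp),
      interiors_eq_empty hneB hb, Set.ncard_empty, zero_mul, add_zero,
      ncard_interiors_reverse hsymm (u := c)]
  have hset₁ : (A ∪ B ∪ C) \ {o} = insert a ((A ∪ B ∪ C) \ {o, a}) := by
    ext x
    simp only [Set.mem_sdiff, Set.mem_union, Set.mem_insert_iff, Set.mem_singleton_iff]
    grind
  have hset₂ : insert o ((A ∪ B ∪ C) \ {o, a}) =
      insert b ((A \ {a, b}) ∪ ((B ∪ C) \ {a, b})) := by
    ext x
    simp only [Set.mem_sdiff, Set.mem_union, Set.mem_insert_iff, Set.mem_singleton_iff]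
    grind
  have hside : ∀ x ∈ A \ {a, b}, ∀ y ∈ (B ∪ C) \ {a, b}, ¬ R x y ∧ ¬ R y x := by
    intro x hx y hy
    simp only [Set.mem_sdiff, Set.mem_union, Set.mem_insert_iff, Set.mem_singleton_iff] at hx hy
    have h₁ := hR x y
    have h₂ := hR y x
    grind
  have hdisj : Disjoint (A \ {a, b}) ((B ∪ C) \ {a, b}) := by
    rw [Set.disjoint_left]
    intro x hx hy
    simp only [Set.mem_sdiff, Set.mem_union, Set.mem_insert_iff, Set.mem_singleton_iff] at hx hy
    grind
  have hba' : a' ≠ b := fun h => hbB (h ▸ haB')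
  rw [hset₁, ncard_interiors_rotate (by simp) (by simp), hset₂,
    ncard_interiors_insert_union hfinA.sdiff (hfinB.union hfinC).sdiff hside hdisj
      ⟨o, hoA, by simp [hoa, hob]⟩ ⟨a', Or.inl haB', by simp [haa', hba']⟩ (by simp) (by simp),
    ncard_interiors_reverse hsymm (T := (B ∪ C) \ {a, b}) (u := a),
    ncard_interiors_reverse hsymm (u := b) (v := a) (T := A \ {a, b}), nBC]
  ring

end Interiors

section Walks

variable {α : Type*} {Γ : SimpleGraph α} {S : Set α} {u v : α}

theorem natCard_walks_eq_ncard {Q : Γ.Walk u v → Prop} {A : Set (List α)}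
    (hA : ∀ m ∈ A, (u :: (m ++ [v])).IsChain Γ.Adj)
    (hnil : ∀ q, Q q → ¬ q.Nil)
    (hQ : ∀ q m, q.support = u :: (m ++ [v]) → (Q q ↔ m ∈ A)) :
    Nat.card {q : Γ.Walk u v // Q q} = A.ncard := by
  have hsupp : ∀ q : Γ.Walk u v, ¬ q.Nil → q.support = u :: (q.support.tail.dropLast ++ [v]) := by
    intro q hq
    cases q with
    | nil => simp at hq
    | cons h q =>
      rw [SimpleGraph.Walk.support_cons, List.tail_cons]
      conv_lhs => rw [← List.dropLast_append_getLast q.support_ne_nil, q.getLast_support]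
  rw [← Nat.card_coe_set_eq]
  refine Nat.card_congr (Equiv.ofBijective
    (fun q => ⟨q.1.support.tail.dropLast, (hQ _ _ (hsupp _ (hnil _ q.2))).1 q.2⟩) ⟨?_, ?_⟩)
  · intro q q' h
    have h' := Subtype.ext_iff.1 h
    simp only at h'
    refine Subtype.ext (SimpleGraph.Walk.ext_support ?_)
    rw [hsupp _ (hnil _ q.2), hsupp _ (hnil _ q'.2), h']
  · rintro ⟨m, hm⟩
    let q : Γ.Walk u v := (SimpleGraph.Walk.ofSupport _ (List.cons_ne_nil _ _) (hA m hm)).copy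
      (by simp) (by simp)
    have hq : q.support = u :: (m ++ [v]) :=
      (SimpleGraph.Walk.support_copy _ _ _).trans (SimpleGraph.Walk.support_ofSupport _ _)
    exact ⟨⟨q, (hQ q m hq).2 hm⟩, Subtype.ext (by simp [hq])⟩

theorem natCard_hamPaths (huv : u ≠ v) (hu : u ∈ S) (hv : v ∈ S) :
    Nat.card {q : Γ.Walk u v // q.IsPath ∧ ∀ x, x ∈ q.support ↔ x ∈ S} =
      (interiors Γ.Adj (S \ {u, v}) u v).ncard := by
  refine natCard_walks_eq_ncard (fun m hm => hm.1)
    (fun q _ => SimpleGraph.Walk.not_nil_of_ne huv) fun q m hq => ?_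
  have hc := q.isChain_adj_support
  rw [SimpleGraph.Walk.isPath_def, hq]
  rw [hq] at hc
  simp only [interiors, Set.mem_ofPred_eq, hc, true_and, Set.mem_sdiff, Set.mem_insert_iff,
    Set.mem_singleton_iff]
  grind

theorem natCard_hamCycles (hu : u ∈ S) (hS : (S \ {u}).Nontrivial) :
    Nat.card {q : Γ.Walk u u // q.IsCycle ∧ ∀ x, x ∈ q.support ↔ x ∈ S} =
      (interiors Γ.Adj (S \ {u}) u u).ncard := by
  refine natCard_walks_eq_ncard (fun m hm => hm.1) (fun q hq => hq.1.not_nil) fun q m hq => ?_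
  have hc := q.isChain_adj_support
  rw [hq] at hc
  have hcyc : (∃ x ∈ m, ∃ y ∈ m, x ≠ y) → (q.IsCycle ↔ (m ++ [u]).Nodup) := by
    rintro ⟨x, hx, y, hy, hxy⟩
    cases q with
    | nil => simp at hq
    | cons h q =>
      rw [SimpleGraph.Walk.support_cons, List.cons.injEq] at hq
      rw [SimpleGraph.Walk.cons_isCycle_iff, SimpleGraph.Walk.isPath_def, hq.2,
        and_iff_left_iff_imp]
      intro hn he
      rw [← hq.2, ← SimpleGraph.Walk.isPath_def] at hn
      rw [Sym2.eq_swap] at he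
      have hl := hn.length_eq_one_of_mem_edges he
      have hl' := congrArg List.length hq.2
      rw [SimpleGraph.Walk.length_support, hl] at hl'
      obtain ⟨z, rfl⟩ : ∃ z, m = [z] := List.length_eq_one_iff.1 (by simpa using hl'.symm)
      rw [List.mem_singleton] at hx hy
      exact hxy (hx.trans hy.symm)
  simp only [hq, interiors, Set.mem_ofPred_eq, hc, true_and, Set.mem_sdiff, Set.mem_singleton_iff]
  constructor
  · rintro ⟨h, hm⟩
    have h' := h.2
    rw [hq] at h'
    have hmem : ∀ x, x ∈ m ↔ x ∈ S ∧ ¬ x = u := by grind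
    exact ⟨by grind, hmem⟩
  · rintro ⟨hn, hm⟩
    obtain ⟨x, hx, y, hy, hxy⟩ := hS
    exact ⟨(hcyc ⟨x, (hm x).2 hx, y, (hm y).2 hy, hxy⟩).2 (by grind), by grind⟩

end Walks

theorem sq3_pos : 0 < sq3 := Real.sqrt_pos.2 (by norm_num)

theorem sq3_mul_self : sq3 * sq3 = 3 := Real.mul_self_sqrt (by norm_num)

theorem a_add_a (n : ℕ) : a n + a n = a (n + 1) := by
  ext <;> simp [a]; ring

theorem b_add_b (n : ℕ) : b n + b n = b (n + 1) := by
  ext <;> simp [b] <;> ring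

theorem V_finite : ∀ n, (V n).Finite
  | 0 => by simp [V]
  | n + 1 => ((V_finite n).union ((V_finite n).image _)).union ((V_finite n).image _)

theorem mem_V_succ {n : ℕ} {x : ℝ × ℝ} :
    x ∈ V (n + 1) ↔ x ∈ V n ∨ (∃ y ∈ V n, y + a n = x) ∨ ∃ y ∈ V n, y + b n = x := by
  simp only [V, Set.mem_union, Set.mem_image, or_assoc]

theorem adj_zero {x y : ℝ × ℝ} :
    (G 0).Adj x y ↔ x ∈ V 0 ∧ y ∈ V 0 ∧ x ≠ y := by
  simp only [G, SimpleGraph.fromEdgeSet_adj, E, V, Set.mem_insert_iff, Set.mem_singleton_iff,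
    Sym2.eq_iff]
  grind

theorem adj_succ {n : ℕ} {x y : ℝ × ℝ} :
    (G (n + 1)).Adj x y ↔ (G n).Adj x y ∨
      (∃ x' y', (G n).Adj x' y' ∧ x' + a n = x ∧ y' + a n = y) ∨
      ∃ x' y', (G n).Adj x' y' ∧ x' + b n = x ∧ y' + b n = y := by
  have key : ∀ t : ℝ × ℝ, (s(x, y) ∈ Sym2.map (· + t) '' E n ∧ x ≠ y ↔
      ∃ x' y', (G n).Adj x' y' ∧ x' + t = x ∧ y' + t = y) := by
    intro t
    constructor
    · rintro ⟨⟨e, he, hxy⟩, hne⟩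
      induction e with
      | _ x' y' =>
        rw [Sym2.map_mk, Sym2.eq_iff] at hxy
        rcases hxy with ⟨rfl, rfl⟩ | ⟨rfl, rfl⟩
        · exact ⟨x', y', ⟨he, fun h => hne (by rw [h])⟩, rfl, rfl⟩
        · have he' : s(y', x') ∈ E n := by rwa [Sym2.eq_swap]
          exact ⟨y', x', ⟨he', fun h => hne (by rw [h])⟩, rfl, rfl⟩
    · rintro ⟨x', y', ⟨he, hne⟩, rfl, rfl⟩
      exact ⟨⟨_, he, rfl⟩, fun h => hne (add_right_cancel h)⟩
  rw [← key, ← key]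
  simp only [G, SimpleGraph.fromEdgeSet_adj, E, Set.mem_union]
  tauto

theorem mem_V_of_adj {n : ℕ} {x y : ℝ × ℝ} (h : (G n).Adj x y) : x ∈ V n ∧ y ∈ V n := by
  induction n generalizing x y with
  | zero => exact ⟨(adj_zero.1 h).1, (adj_zero.1 h).2.1⟩
  | succ n ih =>
    rw [mem_V_succ, mem_V_succ]
    rw [adj_succ] at h
    rcases h with h | ⟨x', y', h, rfl, rfl⟩ | ⟨x', y', h, rfl, rfl⟩
    · exact ⟨Or.inl (ih h).1, Or.inl (ih h).2⟩
    · exact ⟨Or.inr (Or.inl ⟨_, (ih h).1, rfl⟩), Or.inr (Or.inl ⟨_, (ih h).2, rfl⟩)⟩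
    · exact ⟨Or.inr (Or.inr ⟨_, (ih h).1, rfl⟩), Or.inr (Or.inr ⟨_, (ih h).2, rfl⟩)⟩

/-- `V n` lies in the triangle with corners `o`, `a n` and `b n`. -/
theorem mem_triangle_of_mem_V {n : ℕ} {x : ℝ × ℝ} (hx : x ∈ V n) :
    0 ≤ x.2 ∧ x.2 ≤ sq3 * x.1 ∧ sq3 * x.1 + x.2 ≤ sq3 * 2 ^ n := by
  have h3 := sq3_pos
  induction n generalizing x with
  | zero =>
    simp only [V, Set.mem_insert_iff, Set.mem_singleton_iff] at hx
    rcases hx with rfl | rfl | rfl <;> simp only [o, a, b, pow_zero] <;>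
      refine ⟨?_, ?_, ?_⟩ <;> linarith
  | succ n ih =>
    have hp : 0 < sq3 * 2 ^ n := by positivity
    rw [pow_succ]
    rw [mem_V_succ] at hx
    rcases hx with hx | ⟨x, hx, rfl⟩ | ⟨x, hx, rfl⟩
    · obtain ⟨h₁, h₂, h₃⟩ := ih hx
      exact ⟨h₁, h₂, by linarith⟩
    all_goals
      obtain ⟨h₁, h₂, h₃⟩ := ih hx
      simp only [a, b, Prod.fst_add, Prod.snd_add]
      refine ⟨?_, ?_, ?_⟩ <;> linarith

theorem o_mem_V : ∀ n, o ∈ V n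
  | 0 => by simp [V]
  | n + 1 => mem_V_succ.2 (Or.inl (o_mem_V n))

theorem a_mem_V : ∀ n, a n ∈ V n
  | 0 => by simp [V]
  | n + 1 => mem_V_succ.2 (Or.inr (Or.inl ⟨a n, a_mem_V n, a_add_a n⟩))

theorem b_mem_V : ∀ n, b n ∈ V n
  | 0 => by simp [V]
  | n + 1 => mem_V_succ.2 (Or.inr (Or.inr ⟨b n, b_mem_V n, b_add_b n⟩))

theorem eq_of_coords {x y : ℝ × ℝ} (h₂ : x.2 = y.2) (h₁ : sq3 * x.1 = sq3 * y.1) : x = y :=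
  Prod.ext (mul_left_cancel₀ sq3_pos.ne' h₁) h₂

theorem eq_o_of_mem_of_add_a_mem {n : ℕ} {x : ℝ × ℝ} (hx : x ∈ V n) (hx' : x + a n ∈ V n) :
    x = o := by
  obtain ⟨h₁, h₂, h₃⟩ := mem_triangle_of_mem_V hx
  obtain ⟨k₁, k₂, k₃⟩ := mem_triangle_of_mem_V hx'
  simp only [a, Prod.fst_add, Prod.snd_add] at k₁ k₂ k₃
  apply eq_of_coords <;> simp only [o] <;> linarith

theorem eq_o_of_mem_of_add_b_mem {n : ℕ} {x : ℝ × ℝ} (hx : x ∈ V n) (hx' : x + b n ∈ V n) :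
    x = o := by
  obtain ⟨h₁, h₂, h₃⟩ := mem_triangle_of_mem_V hx
  obtain ⟨k₁, k₂, k₃⟩ := mem_triangle_of_mem_V hx'
  simp only [b, Prod.fst_add, Prod.snd_add] at k₁ k₂ k₃
  apply eq_of_coords <;> simp only [o] <;> linarith

theorem eq_of_add_a_eq_add_b {n : ℕ} {x y : ℝ × ℝ} (hx : x ∈ V n) (hy : y ∈ V n)
    (h : x + a n = y + b n) : x = b n ∧ y = a n := by
  obtain ⟨h₁, h₂, h₃⟩ := mem_triangle_of_mem_V hx
  obtain ⟨k₁, k₂, k₃⟩ := mem_triangle_of_mem_V hy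
  have e₁ := congrArg (sq3 * ·) (congrArg Prod.fst h)
  have e₂ := congrArg Prod.snd h
  simp only [a, b, Prod.fst_add, Prod.snd_add] at e₁ e₂
  constructor <;> apply eq_of_coords <;> simp only [a, b] <;> linarith

theorem o_ne_a (n : ℕ) : o ≠ a n :=
  fun h => (pow_pos two_pos n : (0 : ℝ) < 2 ^ n).ne (congrArg Prod.fst h)

theorem o_ne_b (n : ℕ) : o ≠ b n :=
  fun h => (half_pos (pow_pos two_pos n) : (0 : ℝ) < 2 ^ n / 2).ne (congrArg Prod.fst h)

theorem a_ne_b (n : ℕ) : a n ≠ b n := by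
  simp [a, b, sq3_pos.ne']

/-- The reflection of the plane exchanging `a n` and `b n` for every `n`. -/
def reflectDiag (x : ℝ × ℝ) : ℝ × ℝ := ((x.1 + sq3 * x.2) / 2, (sq3 * x.1 - x.2) / 2)

/-- The reflection of the plane exchanging `o` and `a n`. -/
def reflectVert (n : ℕ) (x : ℝ × ℝ) : ℝ × ℝ := (2 ^ n - x.1, x.2)

theorem reflectDiag_involutive : Function.Involutive reflectDiag := by
  intro x
  have := sq3_mul_self
  ext <;> simp only [reflectDiag]
  · linear_combination (x.1 / 4) * this
  · linear_combination (x.2 / 4) * this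

theorem reflectVert_involutive (n : ℕ) : Function.Involutive (reflectVert n) := by
  intro x
  ext <;> simp [reflectVert]

theorem reflectDiag_add (x y : ℝ × ℝ) : reflectDiag (x + y) = reflectDiag x + reflectDiag y := by
  ext <;> simp only [reflectDiag, Prod.fst_add, Prod.snd_add] <;> ring

theorem reflectDiag_o : reflectDiag o = o := by
  ext <;> simp [reflectDiag, o]

theorem reflectDiag_a (n : ℕ) : reflectDiag (a n) = b n := by
  ext <;> simp only [reflectDiag, a, b] <;> ring

theorem reflectDiag_b (n : ℕ) : reflectDiag (b n) = a n := by
  rw [← reflectDiag_a, reflectDiag_involutive]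

theorem reflectVert_o (n : ℕ) : reflectVert n o = a n := by
  ext <;> simp [reflectVert, o, a]

theorem reflectVert_a (n : ℕ) : reflectVert n (a n) = o := by
  ext <;> simp [reflectVert, o, a]

theorem reflectVert_b (n : ℕ) : reflectVert n (b n) = b n := by
  ext <;> simp [reflectVert, b]; ring

theorem reflectVert_succ (n : ℕ) (x : ℝ × ℝ) :
    reflectVert (n + 1) x = reflectVert n x + a n := by
  ext <;> simp [reflectVert, a]; ring

theorem reflectVert_succ_add_a (n : ℕ) (x : ℝ × ℝ) :
    reflectVert (n + 1) (x + a n) = reflectVert n x := by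
  ext <;> simp [reflectVert, a]; ring

theorem reflectVert_succ_add_b (n : ℕ) (x : ℝ × ℝ) :
    reflectVert (n + 1) (x + b n) = reflectVert n x + b n := by
  ext <;> simp [reflectVert, b]; ring

theorem reflectDiag_mem_V {n : ℕ} {x : ℝ × ℝ} (hx : x ∈ V n) : reflectDiag x ∈ V n := by
  induction n generalizing x with
  | zero =>
    simp only [V, Set.mem_insert_iff, Set.mem_singleton_iff] at hx ⊢
    rcases hx with rfl | rfl | rfl <;> simp [reflectDiag_o, reflectDiag_a, reflectDiag_b]
  | succ n ih =>
    rw [mem_V_succ] at hx ⊢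
    rcases hx with hx | ⟨x, hx, rfl⟩ | ⟨x, hx, rfl⟩
    · exact Or.inl (ih hx)
    · exact Or.inr (Or.inr ⟨_, ih hx, by rw [reflectDiag_add, reflectDiag_a]⟩)
    · exact Or.inr (Or.inl ⟨_, ih hx, by rw [reflectDiag_add, reflectDiag_b]⟩)

theorem reflectDiag_adj {n : ℕ} {x y : ℝ × ℝ} (h : (G n).Adj x y) :
    (G n).Adj (reflectDiag x) (reflectDiag y) := by
  induction n generalizing x y with
  | zero =>
    rw [adj_zero] at h ⊢
    exact ⟨reflectDiag_mem_V h.1, reflectDiag_mem_V h.2.1,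
      reflectDiag_involutive.injective.ne h.2.2⟩
  | succ n ih =>
    rw [adj_succ] at h ⊢
    rcases h with h | ⟨x, y, h, rfl, rfl⟩ | ⟨x, y, h, rfl, rfl⟩
    · exact Or.inl (ih h)
    · exact Or.inr (Or.inr ⟨_, _, ih h, by simp only [reflectDiag_add, reflectDiag_a, and_self]⟩)
    · exact Or.inr (Or.inl ⟨_, _, ih h, by simp only [reflectDiag_add, reflectDiag_b, and_self]⟩)

theorem reflectVert_mem_V {n : ℕ} {x : ℝ × ℝ} (hx : x ∈ V n) : reflectVert n x ∈ V n := by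
  induction n generalizing x with
  | zero =>
    simp only [V, Set.mem_insert_iff, Set.mem_singleton_iff] at hx ⊢
    rcases hx with rfl | rfl | rfl <;> simp [reflectVert_o, reflectVert_a, reflectVert_b]
  | succ n ih =>
    rw [mem_V_succ] at hx ⊢
    rcases hx with hx | ⟨x, hx, rfl⟩ | ⟨x, hx, rfl⟩
    · exact Or.inr (Or.inl ⟨_, ih hx, by rw [reflectVert_succ]⟩)
    · exact Or.inl (by rw [reflectVert_succ_add_a]; exact ih hx)
    · exact Or.inr (Or.inr ⟨_, ih hx, by rw [reflectVert_succ_add_b]⟩)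

theorem reflectVert_adj {n : ℕ} {x y : ℝ × ℝ} (h : (G n).Adj x y) :
    (G n).Adj (reflectVert n x) (reflectVert n y) := by
  induction n generalizing x y with
  | zero =>
    rw [adj_zero] at h ⊢
    exact ⟨reflectVert_mem_V h.1, reflectVert_mem_V h.2.1,
      (reflectVert_involutive 0).injective.ne h.2.2⟩
  | succ n ih =>
    rw [adj_succ] at h ⊢
    rcases h with h | ⟨x, y, h, rfl, rfl⟩ | ⟨x, y, h, rfl, rfl⟩
    · exact Or.inr (Or.inl ⟨_, _, ih h, by simp only [reflectVert_succ, and_self]⟩)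
    · exact Or.inl (by simp only [reflectVert_succ_add_a]; exact ih h)
    · exact Or.inr (Or.inr ⟨_, _, ih h, by simp only [reflectVert_succ_add_b, and_self]⟩)

theorem f_eq_ncard_interiors {n : ℕ} {u v : ℝ × ℝ} (huv : u ≠ v) (hu : u ∈ V n) (hv : v ∈ V n) :
    f n u v = (interiors (G n).Adj (V n \ {u, v}) u v).ncard :=
  natCard_hamPaths huv hu hv

theorem f_map_involutive {n : ℕ} {φ : ℝ × ℝ → ℝ × ℝ} (hφ : Function.Involutive φ)
    (hV : ∀ x ∈ V n, φ x ∈ V n) (hadj : ∀ x y, (G n).Adj x y → (G n).Adj (φ x) (φ y))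
    {u v : ℝ × ℝ} (huv : u ≠ v) (hu : u ∈ V n) (hv : v ∈ V n) :
    f n (φ u) (φ v) = f n u v := by
  have himg : φ '' V n = V n := by
    refine Set.Subset.antisymm (Set.image_subset_iff.2 hV) fun x hx => ⟨φ x, hV x hx, hφ x⟩
  rw [f_eq_ncard_interiors huv hu hv,
    f_eq_ncard_interiors (hφ.injective.ne huv) (hV u hu) (hV v hv),
    ← ncard_interiors_image (S := V n) hφ.injective
      (fun x _ y _ => ⟨hadj x y, fun h => by simpa only [hφ x, hφ y] using hadj _ _ h⟩)
      Set.sdiff_subset hu hv,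
    Set.image_sdiff hφ.injective, himg, Set.image_pair]

theorem f_o_b (n : ℕ) : f n o (b n) = f1 n := by
  have := f_map_involutive reflectDiag_involutive (fun _ => reflectDiag_mem_V)
    (fun _ _ => reflectDiag_adj) (o_ne_a n) (o_mem_V n) (a_mem_V n)
  rwa [reflectDiag_o, reflectDiag_a] at this

theorem f_a_b (n : ℕ) : f n (a n) (b n) = f1 n := by
  have := f_map_involutive (reflectVert_involutive n) (fun _ => reflectVert_mem_V)
    (fun _ _ => reflectVert_adj) (o_ne_b n) (o_mem_V n) (b_mem_V n)
  rwa [reflectVert_o, reflectVert_b, f_o_b] at this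

theorem adj_succ_iff {n : ℕ} {x y : ℝ × ℝ} (hx : x ∈ V n) (hy : y ∈ V n) :
    (G n).Adj x y ↔ (G (n + 1)).Adj x y := by
  refine ⟨fun h => adj_succ.2 (Or.inl h), fun h => ?_⟩
  rw [adj_succ] at h
  rcases h with h | ⟨x, y, h, rfl, rfl⟩ | ⟨x, y, h, rfl, rfl⟩
  · exact h
  · exact absurd ((eq_o_of_mem_of_add_a_mem (mem_V_of_adj h).1 hx).trans
      (eq_o_of_mem_of_add_a_mem (mem_V_of_adj h).2 hy).symm) h.ne
  · exact absurd ((eq_o_of_mem_of_add_b_mem (mem_V_of_adj h).1 hx).trans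
      (eq_o_of_mem_of_add_b_mem (mem_V_of_adj h).2 hy).symm) h.ne

theorem adj_succ_add_a_iff {n : ℕ} {x y : ℝ × ℝ} (hx : x ∈ V n) (hy : y ∈ V n) :
    (G n).Adj x y ↔ (G (n + 1)).Adj (x + a n) (y + a n) := by
  refine ⟨fun h => adj_succ.2 (Or.inr (Or.inl ⟨_, _, h, rfl, rfl⟩)), fun h => ?_⟩
  rw [adj_succ] at h
  rcases h with h | ⟨x', y', h, hx', hy'⟩ | ⟨x', y', h, hx', hy'⟩
  · exact absurd ((eq_o_of_mem_of_add_a_mem hx (mem_V_of_adj h).1).trans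
      (eq_o_of_mem_of_add_a_mem hy (mem_V_of_adj h).2).symm) fun e => h.ne (by rw [e])
  · rwa [← add_right_cancel hx', ← add_right_cancel hy']
  · exact absurd ((eq_of_add_a_eq_add_b hx (mem_V_of_adj h).1 hx'.symm).2.trans
      (eq_of_add_a_eq_add_b hy (mem_V_of_adj h).2 hy'.symm).2.symm) h.ne

theorem adj_succ_add_b_iff {n : ℕ} {x y : ℝ × ℝ} (hx : x ∈ V n) (hy : y ∈ V n) :
    (G n).Adj x y ↔ (G (n + 1)).Adj (x + b n) (y + b n) := by
  refine ⟨fun h => adj_succ.2 (Or.inr (Or.inr ⟨_, _, h, rfl, rfl⟩)), fun h => ?_⟩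
  rw [adj_succ] at h
  rcases h with h | ⟨x', y', h, hx', hy'⟩ | ⟨x', y', h, hx', hy'⟩
  · exact absurd ((eq_o_of_mem_of_add_b_mem hx (mem_V_of_adj h).1).trans
      (eq_o_of_mem_of_add_b_mem hy (mem_V_of_adj h).2).symm) fun e => h.ne (by rw [e])
  · exact absurd ((eq_of_add_a_eq_add_b (mem_V_of_adj h).1 hx hx').1.trans
      (eq_of_add_a_eq_add_b (mem_V_of_adj h).2 hy hy').1.symm) h.ne
  · rwa [← add_right_cancel hx', ← add_right_cancel hy']

theorem ncard_interiors_succ_image {n : ℕ} {φ : ℝ × ℝ → ℝ × ℝ} (hφ : Function.Injective φ)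
    (hadj : ∀ x ∈ V n, ∀ y ∈ V n, (G n).Adj x y ↔ (G (n + 1)).Adj (φ x) (φ y))
    {u v : ℝ × ℝ} (huv : u ≠ v) (hu : u ∈ V n) (hv : v ∈ V n) :
    (interiors (G (n + 1)).Adj (φ '' V n \ {φ u, φ v}) (φ u) (φ v)).ncard = f n u v := by
  rw [f_eq_ncard_interiors huv hu hv, ← ncard_interiors_image hφ hadj Set.sdiff_subset hu hv,
    Set.image_sdiff hφ, Set.image_pair]

/-- The closed walks based at `o` through all vertices of `SG (n + 1)`, counted by cutting them at
the three vertices shared by two of the copies of `SG n`. -/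
theorem ncard_interiors_V_succ (n : ℕ) :
    (interiors (G (n + 1)).Adj (V (n + 1) \ {o}) o o).ncard = 2 * f1 n ^ 3 := by
  have ho : ∀ x : ℝ × ℝ, o + x = x := fun x => zero_add x
  have hA := ncard_interiors_succ_image Function.injective_id
    (fun x hx y hy => adj_succ_iff hx hy) (a_ne_b n) (a_mem_V n) (b_mem_V n)
  have hB := ncard_interiors_succ_image (add_left_injective (a n))
    (fun x hx y hy => adj_succ_add_a_iff hx hy) (o_ne_b n) (o_mem_V n) (b_mem_V n)
  have hC := ncard_interiors_succ_image (add_left_injective (b n))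
    (fun x hx y hy => adj_succ_add_b_iff hx hy) (o_ne_a n) (o_mem_V n) (a_mem_V n)
  simp only [ho, id_eq, Set.image_id', f_a_b, f_o_b, add_comm (a n) (b n)] at hA hB hC
  have hcop : ∀ t : ℝ × ℝ, ∀ x y z : ℝ × ℝ, x ≠ y → x + t = z → z ≠ y + t := by
    rintro t x y _ hxy rfl h
    exact hxy (add_right_cancel h)
  have key := ncard_interiors_three_pieces (R := (G (n + 1)).Adj) (A := V n)
    (B := (· + a n) '' V n) (C := (· + b n) '' V n) (o := o) (a := a n) (b := b n) (c := b n + a n)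
    (a' := a (n + 1)) (b' := b (n + 1)) (V_finite n) ((V_finite n).image _) ((V_finite n).image _)
    (fun _ _ h => h.symm) ?_ ?_ ?_ ?_ (o_mem_V n) (a_mem_V n) (b_mem_V n)
    ⟨o, o_mem_V n, ho _⟩ ⟨b n, b_mem_V n, rfl⟩ ⟨o, o_mem_V n, ho _⟩
    ⟨a n, a_mem_V n, a_add_a n⟩ ⟨b n, b_mem_V n, b_add_b n⟩
    (o_ne_a n) (o_ne_b n) (a_ne_b n)
    (hcop _ _ _ _ (o_ne_b n) (ho _)) ?_ ?_ (hcop _ _ _ _ (a_ne_b n) (a_add_a n)) ?_ ?_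
  · rw [hA, hB, hC] at key
    rw [V, key, f1]
    ring
  · rintro _ hx ⟨x, hx', rfl⟩
    simp only [eq_o_of_mem_of_add_a_mem hx' hx, ho]
  · rintro _ hx ⟨x, hx', rfl⟩
    simp only [eq_o_of_mem_of_add_b_mem hx' hx, ho]
  · rintro _ ⟨x, hx, rfl⟩ ⟨y, hy, hxy⟩
    simp only [(eq_of_add_a_eq_add_b hx hy hxy.symm).1]
  · intro x y h
    rw [adj_succ] at h
    rcases h with h | ⟨x, y, h, rfl, rfl⟩ | ⟨x, y, h, rfl, rfl⟩
    · exact Or.inl (mem_V_of_adj h)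
    · exact Or.inr (Or.inl ⟨⟨x, (mem_V_of_adj h).1, rfl⟩, ⟨y, (mem_V_of_adj h).2, rfl⟩⟩)
    · exact Or.inr (Or.inr ⟨⟨x, (mem_V_of_adj h).1, rfl⟩, ⟨y, (mem_V_of_adj h).2, rfl⟩⟩)
  · rw [add_comm]
    exact hcop _ _ _ _ (o_ne_a n) (ho _)
  · exact (hcop _ _ _ _ (o_ne_a n) (ho _)).symm ∘ fun h => by rw [a_add_a, h]
  · exact (hcop _ _ _ _ (o_ne_b n) (ho _)).symm ∘ fun h => by rw [b_add_b, h]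
  · rw [add_comm (b n)]
    exact hcop _ _ _ _ (a_ne_b n).symm (b_add_b n)

theorem HC_eq (n : ℕ) (hn : 1 ≤ n) : HC n = f1 (n - 1) ^ 3 := by
  obtain ⟨n, rfl⟩ := Nat.exists_eq_add_of_le' hn
  have hS : (V (n + 1) \ {o}).Nontrivial :=
    ⟨a (n + 1), ⟨a_mem_V _, (o_ne_a _).symm⟩, b (n + 1), ⟨b_mem_V _, (o_ne_b _).symm⟩, a_ne_b _⟩
  have h := natCard_hamCycles (Γ := G (n + 1)) (o_mem_V (n + 1)) hS
  rw [ncard_interiors_V_succ] at h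
  rw [HC, Nat.add_sub_cancel]
  unfold IsHamCycle
  rw [h, Nat.mul_div_cancel_left _ two_pos]

/-- for `n ≥ 2`, `HC n = f1 (n-1) ^ 3`. -/
theorem HC_eq_f1_cubed : ∀ n : ℕ, 2 ≤ n → HC n = f1 (n - 1) ^ 3 :=
  fun n hn => HC_eq n (one_le_two.trans hn)

end SierpinskiGasket
end
end

section
/- For Hamiltonian paths on SG(n) with one end at o, the distribution ratio at the corner vertices is: F(n,a_n) = F(n,b_n) = 1 for n ≥ 0 (with n = m); F(n,a_m) = F(n,b_m) = 1/2 for 0 < m < n; F(1,a_0) = F(1,b_0) = 1/2; F(n,a_0) = F(n,b_0) = 1/3 for n > 1; F(n,c_{n−1}) = 0 for n ≥ 1; F(n,c_m) = 1 for 0 < m < n−1; and F(n,c_0) = 2/3 for n > 1. -/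
open scoped Classical
open Filter Topology

noncomputable section

namespace SierpinskiGasket

section Lists

variable {α : Type*}

/-- the list `m` is the interior of an `r`-chain from `u` to `v` -/
def Ch (r : α → α → Prop) (u : α) (m : List α) (v : α) : Prop :=
  (u :: (m ++ [v])).IsChain r

theorem ch_nil {r : α → α → Prop} {u v : α} : Ch r u [] v ↔ r u v := by simp [Ch]

theorem ch_cons {r : α → α → Prop} {u q v : α} {m : List α} :
    Ch r u (q :: m) v ↔ r u q ∧ Ch r q m v := by simp [Ch]

theorem ch_append {r : α → α → Prop} {u p v : α} {m₁ m₂ : List α} :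
    Ch r u (m₁ ++ p :: m₂) v ↔ Ch r u m₁ p ∧ Ch r p m₂ v := by
  simp only [Ch, List.append_assoc, List.cons_append]
  exact List.isChain_cons_split

theorem Ch.imp {r s : α → α → Prop} (h : ∀ p q, r p q → s p q) {u v : α} {m : List α}
    (hc : Ch r u m v) : Ch s u m v := List.IsChain.imp h hc

theorem Ch.mem {r : α → α → Prop} {A : Set α} (h : ∀ p q, r p q → p ∈ A ∧ q ∈ A) {u v : α}
    {m : List α} (hc : Ch r u m v) : u ∈ A ∧ v ∈ A ∧ ∀ t ∈ m, t ∈ A := by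
  induction m generalizing u with
  | nil => simpa using h _ _ (ch_nil.1 hc)
  | cons q m ih =>
    obtain ⟨h1, h2⟩ := ch_cons.1 hc
    have := ih h2
    have := h _ _ h1
    simp_all

def Fst (s : α → α → Prop) (u : α) (m : List α) (v : α) : Prop :=
  ∃ q ∈ (m ++ [v]).head?, s u q

theorem peel_aux {r s w : α → α → Prop} (h : ∀ p q, r p q → s p q ∨ w p q) {u v : α}
    {m : List α} (hc : Ch r u m v) (hf : Fst s u m v) :
    Ch s u m v ∨ ∃ m₁ p m₂, m = m₁ ++ p :: m₂ ∧ Ch s u m₁ p ∧ Ch r p m₂ v ∧ Fst w p m₂ v := by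
  induction m generalizing u with
  | nil => left; simpa [Fst, ch_nil] using hf
  | cons q m ih =>
    obtain ⟨h1, h2⟩ := ch_cons.1 hc
    have hs : s u q := by simpa [Fst] using hf
    have : Fst s q m v ∨ Fst w q m v := by
      cases m with
      | nil => simpa [Fst] using h _ _ (ch_nil.1 h2)
      | cons q' m => simpa [Fst] using h _ _ (ch_cons.1 h2).1
    rcases this with h3 | h3
    · rcases ih h2 h3 with h4 | ⟨m₁, p, m₂, rfl, h4, h5⟩
      · exact Or.inl (ch_cons.2 ⟨hs, h4⟩)
      · exact Or.inr ⟨q :: m₁, p, m₂, rfl, ch_cons.2 ⟨hs, h4⟩, h5⟩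
    · exact Or.inr ⟨[], q, m, rfl, ch_nil.2 hs, h2, h3⟩

/-- the relation `r` on `S` is glued from three pieces that share the vertices `x`, `y`, `z` pairwise -/
structure Glue (r rA rB rC : α → α → Prop) (S A B C : Set α) (x y z : α) : Prop where
  rel : ∀ p q, r p q ↔ rA p q ∨ rB p q ∨ rC p q
  supA : ∀ p q, rA p q → p ∈ A ∧ q ∈ A
  supB : ∀ p q, rB p q → p ∈ B ∧ q ∈ B
  supC : ∀ p q, rC p q → p ∈ C ∧ q ∈ C
  cover : ∀ p, p ∈ S ↔ p ∈ A ∨ p ∈ B ∨ p ∈ C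
  xA : x ∈ A
  xB : x ∈ B
  xC : x ∉ C
  yA : y ∈ A
  yB : y ∉ B
  yC : y ∈ C
  zA : z ∉ A
  zB : z ∈ B
  zC : z ∈ C
  AB : ∀ p ∈ A, p ∈ B → p = x
  AC : ∀ p ∈ A, p ∈ C → p = y
  BC : ∀ p ∈ B, p ∈ C → p = z

/-- the interiors of the Hamiltonian paths of `S` from `u` to `v` -/
def IP (r : α → α → Prop) (S : Set α) (u v : α) : Set (List α) :=
  {m | (u :: (m ++ [v])).Nodup ∧ Ch r u m v ∧ ∀ t, t ∈ u :: (m ++ [v]) ↔ t ∈ S}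

/-- the interiors of the pairs of disjoint paths with prescribed ends that together
visit every vertex of `S` -/
def IQ (r : α → α → Prop) (S : Set α) (u v u' v' : α) : Set (List α × List α) :=
  {m | (u :: (m.1 ++ v :: u' :: (m.2 ++ [v']))).Nodup ∧ Ch r u m.1 v ∧ Ch r u' m.2 v' ∧
    ∀ t, t ∈ u :: (m.1 ++ v :: u' :: (m.2 ++ [v'])) ↔ t ∈ S}

theorem mem_IP {r : α → α → Prop} {S : Set α} {u v : α} {m : List α} :
    m ∈ IP r S u v ↔ ((u ∉ m ∧ u ≠ v) ∧ m.Nodup ∧ v ∉ m) ∧ Ch r u m v ∧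
      ∀ t, (t = u ∨ t ∈ m ∨ t = v) ↔ t ∈ S := by
  simp [IP, List.nodup_append', and_assoc]

theorem nodup_join {y : α} {m₁ m₂ : List α} :
    (m₁ ++ y :: m₂).Nodup ↔ m₁.Nodup ∧ m₂.Nodup ∧ y ∉ m₁ ∧ y ∉ m₂ ∧ ∀ t ∈ m₁, t ∉ m₂ := by
  simp only [List.nodup_append', List.nodup_cons, List.disjoint_left, List.mem_cons]
  grind

theorem mem_IQ {r : α → α → Prop} {S : Set α} {u v u' v' : α} {m₁ m₂ : List α} :
    (m₁, m₂) ∈ IQ r S u v u' v' ↔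
      ((u ≠ v ∧ u ≠ u' ∧ u ≠ v' ∧ v ≠ u' ∧ v ≠ v' ∧ u' ≠ v') ∧
        (u ∉ m₁ ∧ v ∉ m₁ ∧ u' ∉ m₁ ∧ v' ∉ m₁) ∧ (u ∉ m₂ ∧ v ∉ m₂ ∧ u' ∉ m₂ ∧ v' ∉ m₂) ∧
        m₁.Nodup ∧ m₂.Nodup ∧ ∀ t ∈ m₁, t ∉ m₂) ∧ Ch r u m₁ v ∧ Ch r u' m₂ v' ∧
      ∀ t, (t = u ∨ t ∈ m₁ ∨ t = v ∨ t = u' ∨ t ∈ m₂ ∨ t = v') ↔ t ∈ S := by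
  simp only [IQ, Set.mem_ofPred_eq, List.nodup_cons, List.nodup_append', List.disjoint_left,
    List.mem_cons, List.mem_append, List.not_mem_nil, or_false, List.nodup_nil]
  refine and_congr_left fun _ => ?_
  grind only

theorem join_inj {y : α} {m₁ m₂ k₁ k₂ : List α} (h : y ∉ m₁) (h' : y ∉ k₁)
    (e : m₁ ++ y :: m₂ = k₁ ++ y :: k₂) : m₁ = k₁ ∧ m₂ = k₂ := by
  induction m₁ generalizing k₁ with
  | nil => cases k₁ with
    | nil => simpa using e
    | cons t k₁ => grind
  | cons s m₁ ih => cases k₁ with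
    | nil => grind
    | cons t k₁ =>
      simp only [List.cons_append, List.cons.injEq] at e
      have := ih (List.not_mem_of_not_mem_cons h) (List.not_mem_of_not_mem_cons h') e.2
      simp [e.1, this]

namespace Glue
variable {r rA rB rC : α → α → Prop} {S A B C : Set α} {x y z : α}

theorem swap (g : Glue r rA rB rC S A B C x y z) : Glue r rA rC rB S A C B y x z where
  rel p q := by rw [g.rel]; tauto
  supA := g.supA
  supB := g.supC
  supC := g.supB
  cover p := by rw [g.cover]; tauto
  xA := g.yA
  xB := g.yC
  xC := g.yB
  yA := g.xA
  yB := g.xC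
  yC := g.xB
  zA := g.zA
  zB := g.zC
  zC := g.zB
  AB := g.AC
  AC := g.AB
  BC p h h' := g.BC p h' h

theorem rot (g : Glue r rA rB rC S A B C x y z) : Glue r rB rC rA S B C A z x y where
  rel p q := by rw [g.rel]; tauto
  supA := g.supB
  supB := g.supC
  supC := g.supA
  cover p := by rw [g.cover]; tauto
  xA := g.zB
  xB := g.zC
  xC := g.zA
  yA := g.xB
  yB := g.xC
  yC := g.xA
  zA := g.yB
  zB := g.yC
  zC := g.yA
  AB := g.BC
  AC p h h' := g.AB p h' h
  BC p h h' := g.AC p h' h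

theorem peel (g : Glue r rA rB rC S A B C x y z) {u v : α} {m : List α} (hc : Ch r u m v)
    (hf : Fst rA u m v) : Ch rA u m v ∨
      (∃ m₁ m₂, m = m₁ ++ x :: m₂ ∧ Ch rA u m₁ x ∧ Ch r x m₂ v ∧ Fst rB x m₂ v) ∨
      (∃ m₁ m₂, m = m₁ ++ y :: m₂ ∧ Ch rA u m₁ y ∧ Ch r y m₂ v ∧ Fst rC y m₂ v) := by
  rcases peel_aux (w := fun p q => rB p q ∨ rC p q) (fun p q h => (g.rel p q).1 h) hc hf with
    h | ⟨m₁, p, m₂, rfl, h1, h2, q, hq, h | h⟩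
  · exact Or.inl h
  · obtain rfl := g.AB p (h1.mem g.supA).2.1 (g.supB _ _ h).1
    exact Or.inr (Or.inl ⟨m₁, m₂, rfl, h1, h2, q, hq, h⟩)
  · obtain rfl := g.AC p (h1.mem g.supA).2.1 (g.supC _ _ h).1
    exact Or.inr (Or.inr ⟨m₁, m₂, rfl, h1, h2, q, hq, h⟩)

theorem fst (g : Glue r rA rB rC S A B C x y z) {u v : α} {m : List α} (hc : Ch r u m v)
    (hB : u ∉ B) (hC : u ∉ C) : Fst rA u m v := by
  have key : ∀ q, r u q → rA u q := fun q h => by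
    rcases (g.rel _ _).1 h with h | h | h
    · exact h
    · exact absurd (g.supB _ _ h).1 hB
    · exact absurd (g.supC _ _ h).1 hC
  cases m with
  | nil => simpa [Fst] using key _ (ch_nil.1 hc)
  | cons q' m => simpa [Fst] using key _ (ch_cons.1 hc).1

theorem impA (g : Glue r rA rB rC S A B C x y z) {u v : α} {m : List α} (h : Ch rA u m v) :
    Ch r u m v := h.imp fun p q h => (g.rel p q).2 (Or.inl h)

/-- A path leaving an inner vertex of `A` visits the three pieces in one of seven orders. -/
theorem words (g : Glue r rA rB rC S A B C x y z) {u v : α} {m : List α} (hc : Ch r u m v)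
    (hB : u ∉ B) (hC : u ∉ C) (hn : m.Nodup) :
    Ch rA u m v ∨
    (∃ m₁ m₂, m = m₁ ++ x :: m₂ ∧ Ch rA u m₁ x ∧ Ch rB x m₂ v) ∨
    (∃ m₁ m₂, m = m₁ ++ y :: m₂ ∧ Ch rA u m₁ y ∧ Ch rC y m₂ v) ∨
    (∃ m₁ m₂ m₃, m = m₁ ++ x :: (m₂ ++ z :: m₃) ∧
      Ch rA u m₁ x ∧ Ch rB x m₂ z ∧ Ch rC z m₃ v) ∨
    (∃ m₁ m₂ m₃, m = m₁ ++ y :: (m₂ ++ z :: m₃) ∧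
      Ch rA u m₁ y ∧ Ch rC y m₂ z ∧ Ch rB z m₃ v) ∨
    (∃ m₁ m₂ m₃ m₄, m = m₁ ++ x :: (m₂ ++ z :: (m₃ ++ y :: m₄)) ∧
      Ch rA u m₁ x ∧ Ch rB x m₂ z ∧ Ch rC z m₃ y ∧ Ch rA y m₄ v) ∨
    (∃ m₁ m₂ m₃ m₄, m = m₁ ++ y :: (m₂ ++ z :: (m₃ ++ x :: m₄)) ∧
      Ch rA u m₁ y ∧ Ch rC y m₂ z ∧ Ch rB z m₃ x ∧ Ch rA x m₄ v) := by
  rcases g.peel hc (g.fst hc hB hC) with h | ⟨m₁, m, rfl, h1, hc, hf⟩ | ⟨m₁, m, rfl, h1, hc, hf⟩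
  · exact Or.inl h
  · rcases g.rot.peel hc hf with h | ⟨m₂, m, rfl, h2, hc, hf⟩ | ⟨m₂, m, rfl, h2, hc, hf⟩
    · exact Or.inr (Or.inl ⟨_, _, rfl, h1, h⟩)
    · rcases g.rot.rot.peel hc hf with h | ⟨m₃, m, rfl, h3, hc, hf⟩ | ⟨m₃, m, rfl, h3, hc, hf⟩
      · exact Or.inr (Or.inr (Or.inr (Or.inl ⟨_, _, _, rfl, h1, h2, h⟩)))
      · rcases g.peel hc hf with h | ⟨m₁, m, rfl, -⟩ | ⟨m₁, m, rfl, -⟩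
        · exact Or.inr (Or.inr (Or.inr (Or.inr (Or.inr (Or.inl ⟨_, _, _, _, rfl, h1, h2, h3, h⟩)))))
        all_goals simp [nodup_join] at hn
      · simp [nodup_join] at hn
    · simp [nodup_join] at hn
  · rcases g.swap.rot.peel hc hf with h | ⟨m₂, m, rfl, h2, hc, hf⟩ | ⟨m₂, m, rfl, h2, hc, hf⟩
    · exact Or.inr (Or.inr (Or.inl ⟨_, _, rfl, h1, h⟩))
    · rcases g.swap.rot.rot.peel hc hf with h | ⟨m₃, m, rfl, h3, hc, hf⟩ | ⟨m₃, m, rfl, h3, hc, hf⟩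
      · exact Or.inr (Or.inr (Or.inr (Or.inr (Or.inl ⟨_, _, _, rfl, h1, h2, h⟩))))
      · rcases g.swap.peel hc hf with h | ⟨m₁, m, rfl, -⟩ | ⟨m₁, m, rfl, -⟩
        · exact Or.inr (Or.inr (Or.inr (Or.inr (Or.inr (Or.inr ⟨_, _, _, _, rfl, h1, h2, h3, h⟩)))))
        all_goals simp [nodup_join] at hn
      · simp [nodup_join] at hn
    · simp [nodup_join] at hn


theorem encard_cross (g : Glue r rA rB rC S A B C x y z) {u v : α} (huB : u ∉ B)
    (huC : u ∉ C) (hvA : v ∉ A) (hvC : v ∉ C) (hC : ∃ t ∈ C, t ≠ y ∧ t ≠ z) :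
    (IP r S u v).encard =
      (IP rA A u y).encard * (IP rC C y z).encard * (IP rB (B \ {x}) z v).encard +
      (IP rA (A \ {x}) u y).encard * (IP rC C y z).encard * (IP rB B z v).encard := by
  have key : IP r S u v =
      (fun t : List α × List α × List α => t.1 ++ y :: (t.2.1 ++ z :: t.2.2)) ''
      (IP rA A u y ×ˢ IP rC C y z ×ˢ IP rB (B \ {x}) z v ∪
       IP rA (A \ {x}) u y ×ˢ IP rC C y z ×ˢ IP rB B z v) := by
    ext m
    obtain ⟨e, heC, hey, hez⟩ := hC
    obtain ⟨rel, supA, supB, supC, cover, xA, xB, xC, yA, yB, yC, zA, zB, zC, AB, AC, BC⟩ := id g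
    constructor
    · intro hm
      obtain ⟨hn, hc, hS⟩ := mem_IP.1 hm
      rcases g.words hc huB huC hn.2.1 with h | ⟨m₁, m₂, rfl, h1, h2⟩ | ⟨m₁, m₂, rfl, h1, h2⟩ |
        ⟨m₁, m₂, m₃, rfl, h1, h2, h3⟩ | ⟨m₁, m₂, m₃, rfl, h1, h2, h3⟩ |
        ⟨m₁, m₂, m₃, m₄, rfl, h1, h2, h3, h4⟩ | ⟨m₁, m₂, m₃, m₄, rfl, h1, h2, h3, h4⟩
      · exact absurd (h.mem supA).2.1 hvA
      · have := h1.mem supA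
        have := h2.mem supB
        have := hS e
        simp only [List.mem_cons, List.mem_append] at this
        grind only
      · exact absurd (h2.mem supC).2.1 hvC
      · exact absurd (h3.mem supC).2.1 hvC
      · refine ⟨(m₁, m₂, m₃), ?_, rfl⟩
        have := h1.mem supA
        have := h2.mem supC
        have := h3.mem supB
        simp only [nodup_join, List.mem_cons, List.mem_append] at hn hS
        simp only [Set.mem_union, Set.mem_prod, mem_IP, Set.mem_sdiff, Set.mem_singleton_iff,
          h1, h2, h3]
        by_cases hx : x ∈ m₁
        · left
          grind only
        · right
          grind only
      · exact absurd (h4.mem supA).2.1 hvA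
      · exact absurd (h4.mem supA).2.1 hvA
    · rintro ⟨⟨m₁, m₂, m₃⟩, H, rfl⟩
      simp only [Set.mem_union, Set.mem_prod, mem_IP, Set.mem_sdiff, Set.mem_singleton_iff] at H
      simp only [nodup_join, List.mem_cons, List.mem_append, mem_IP]
      rcases H with ⟨⟨n1, c1, s1⟩, ⟨n2, c2, s2⟩, ⟨n3, c3, s3⟩⟩ |
        ⟨⟨n1, c1, s1⟩, ⟨n2, c2, s2⟩, ⟨n3, c3, s3⟩⟩
      all_goals
        refine ⟨?_, ch_append.2 ⟨g.impA c1, ch_append.2 ⟨g.swap.rot.impA c2, g.rot.impA c3⟩⟩, ?_⟩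
        · grind only
        · grind only
  rw [key, Set.InjOn.encard_image, Set.encard_union_eq]
  · simp only [Set.encard_prod, mul_assoc]
  · rw [Set.disjoint_left]
    rintro ⟨m₁, m₂, m₃⟩ h h'
    have := g.xA
    have := g.xC
    have := g.yC
    simp only [Set.mem_prod, mem_IP, Set.mem_sdiff, Set.mem_singleton_iff] at h h'
    grind only
  · rintro ⟨m₁, m₂, m₃⟩ h ⟨k₁, k₂, k₃⟩ h' e
    simp only [Set.mem_union, Set.mem_prod, mem_IP] at h h'
    obtain ⟨rfl, e⟩ := join_inj (by tauto) (by tauto) e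
    obtain ⟨rfl, rfl⟩ := join_inj (by tauto) (by tauto) e
    rfl

/-- paths whose ends are both inner vertices of `A` -/
theorem encard_inner (g : Glue r rA rB rC S A B C x y z) {u v : α} (huB : u ∉ B)
    (huC : u ∉ C) (hvB : v ∉ B) (hvC : v ∉ C) :
    (IP r S u v).encard =
      (IQ rA A u x y v).encard * (IP rB B x z).encard * (IP rC C z y).encard +
      (IQ rA A u y x v).encard * (IP rC C y z).encard * (IP rB B z x).encard := by
  have key : IP r S u v =
      (fun t : (List α × List α) × List α × List α =>
        t.1.1 ++ x :: (t.2.1 ++ z :: (t.2.2 ++ y :: t.1.2))) ''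
          (IQ rA A u x y v ×ˢ IP rB B x z ×ˢ IP rC C z y) ∪
      (fun t : (List α × List α) × List α × List α =>
        t.1.1 ++ y :: (t.2.1 ++ z :: (t.2.2 ++ x :: t.1.2))) ''
          (IQ rA A u y x v ×ˢ IP rC C y z ×ˢ IP rB B z x) := by
    ext m
    obtain ⟨rel, supA, supB, supC, cover, xA, xB, xC, yA, yB, yC, zA, zB, zC, AB, AC, BC⟩ := id g
    constructor
    · intro hm
      obtain ⟨hn, hc, hS⟩ := mem_IP.1 hm
      rcases g.words hc huB huC hn.2.1 with h | ⟨m₁, m₂, rfl, h1, h2⟩ | ⟨m₁, m₂, rfl, h1, h2⟩ |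
        ⟨m₁, m₂, m₃, rfl, h1, h2, h3⟩ | ⟨m₁, m₂, m₃, rfl, h1, h2, h3⟩ |
        ⟨m₁, m₂, m₃, m₄, rfl, h1, h2, h3, h4⟩ | ⟨m₁, m₂, m₃, m₄, rfl, h1, h2, h3, h4⟩
      · have := h.mem supA
        have := hS z
        grind only
      · exact absurd (h2.mem supB).2.1 hvB
      · exact absurd (h2.mem supC).2.1 hvC
      · exact absurd (h3.mem supC).2.1 hvC
      · exact absurd (h3.mem supB).2.1 hvB
      · refine Or.inl ⟨((m₁, m₄), m₂, m₃), ?_, rfl⟩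
        have := h1.mem supA
        have := h2.mem supB
        have := h3.mem supC
        have := h4.mem supA
        simp only [nodup_join, List.mem_cons, List.mem_append] at hn hS
        simp only [Set.mem_prod, mem_IP, mem_IQ, h1, h2, h3, h4]
        grind only
      · refine Or.inr ⟨((m₁, m₄), m₂, m₃), ?_, rfl⟩
        have := h1.mem supA
        have := h2.mem supC
        have := h3.mem supB
        have := h4.mem supA
        simp only [nodup_join, List.mem_cons, List.mem_append] at hn hS
        simp only [Set.mem_prod, mem_IP, mem_IQ, h1, h2, h3, h4]
        grind only
    · rintro (⟨⟨⟨m₁, m₄⟩, m₂, m₃⟩, H, rfl⟩ | ⟨⟨⟨m₁, m₄⟩, m₂, m₃⟩, H, rfl⟩)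
      · simp only [Set.mem_prod, mem_IP, mem_IQ] at H
        simp only [nodup_join, List.mem_cons, List.mem_append, mem_IP]
        obtain ⟨⟨n1, c1, c4, s1⟩, ⟨n2, c2, s2⟩, ⟨n3, c3, s3⟩⟩ := H
        refine ⟨?_, ch_append.2 ⟨g.impA c1, ch_append.2 ⟨g.rot.impA c2, ch_append.2
          ⟨g.rot.rot.impA c3, g.impA c4⟩⟩⟩, ?_⟩
        · grind only
        · grind only
      · simp only [Set.mem_prod, mem_IP, mem_IQ] at H
        simp only [nodup_join, List.mem_cons, List.mem_append, mem_IP]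
        obtain ⟨⟨n1, c1, c4, s1⟩, ⟨n2, c2, s2⟩, ⟨n3, c3, s3⟩⟩ := H
        refine ⟨?_, ch_append.2 ⟨g.impA c1, ch_append.2 ⟨g.rot.rot.impA c2, ch_append.2
          ⟨g.rot.impA c3, g.impA c4⟩⟩⟩, ?_⟩
        · grind only
        · grind only
  have hyB := g.yB
  have hyC := g.yC
  have hxC := g.xC
  rw [key, Set.encard_union_eq, Set.InjOn.encard_image, Set.InjOn.encard_image]
  · simp only [Set.encard_prod, mul_assoc]
  · rintro ⟨⟨m₁, m₄⟩, m₂, m₃⟩ h ⟨⟨k₁, k₄⟩, k₂, k₃⟩ h' e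
    simp only [Set.mem_prod, mem_IP, mem_IQ] at h h'
    obtain ⟨rfl, e⟩ := join_inj (by tauto) (by tauto) e
    obtain ⟨rfl, e⟩ := join_inj (by tauto) (by tauto) e
    obtain ⟨rfl, rfl⟩ := join_inj (by tauto) (by tauto) e
    rfl
  · rintro ⟨⟨m₁, m₄⟩, m₂, m₃⟩ h ⟨⟨k₁, k₄⟩, k₂, k₃⟩ h' e
    simp only [Set.mem_prod, mem_IP, mem_IQ] at h h'
    obtain ⟨rfl, e⟩ := join_inj (by tauto) (by tauto) e
    obtain ⟨rfl, e⟩ := join_inj (by tauto) (by tauto) e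
    obtain ⟨rfl, rfl⟩ := join_inj (by tauto) (by tauto) e
    rfl
  · rw [Set.disjoint_left]
    rintro _ ⟨⟨⟨m₁, m₄⟩, m₂, m₃⟩, h, rfl⟩ ⟨⟨⟨k₁, k₄⟩, k₂, k₃⟩, h', e⟩
    simp only [Set.mem_prod, mem_IP, mem_IQ] at h h'
    have hy : y ∉ m₁ := by tauto
    have hx : x ∉ k₁ := by tauto
    have hxy : x ≠ y := by grind only
    simp only at e
    rcases List.append_eq_append_iff.1 e with ⟨l, e1, e2⟩ | ⟨l, e1, e2⟩
    · cases l with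
      | nil => simp_all
      | cons b l => simp only [List.cons_append, List.cons.injEq] at e2; simp_all
    · cases l with
      | nil => simp_all
      | cons b l => simp only [List.cons_append, List.cons.injEq] at e2; simp_all

/-- paths from an inner vertex of `A` to the common vertex of `A` and `B` -/
theorem encard_to_x (g : Glue r rA rB rC S A B C x y z) {u : α} (huB : u ∉ B) (huC : u ∉ C) :
    (IP r S u x).encard =
      (IP rA (A \ {x}) u y).encard * (IP rC C y z).encard * (IP rB B z x).encard := by
  have key : IP r S u x =
      (fun t : List α × List α × List α => t.1 ++ y :: (t.2.1 ++ z :: t.2.2)) ''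
       (IP rA (A \ {x}) u y ×ˢ IP rC C y z ×ˢ IP rB B z x) := by
    ext m
    obtain ⟨rel, supA, supB, supC, cover, xA, xB, xC, yA, yB, yC, zA, zB, zC, AB, AC, BC⟩ := id g
    constructor
    · intro hm
      obtain ⟨hn, hc, hS⟩ := mem_IP.1 hm
      rcases g.words hc huB huC hn.2.1 with h | ⟨m₁, m₂, rfl, h1, h2⟩ | ⟨m₁, m₂, rfl, h1, h2⟩ |
        ⟨m₁, m₂, m₃, rfl, h1, h2, h3⟩ | ⟨m₁, m₂, m₃, rfl, h1, h2, h3⟩ |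
        ⟨m₁, m₂, m₃, m₄, rfl, h1, h2, h3, h4⟩ | ⟨m₁, m₂, m₃, m₄, rfl, h1, h2, h3, h4⟩
      · have := h.mem supA
        have := hS z
        grind only
      · simp at hn
      · exact absurd (h2.mem supC).2.1 xC
      · exact absurd (h3.mem supC).2.1 xC
      · refine ⟨(m₁, m₂, m₃), ?_, rfl⟩
        have := h1.mem supA
        have := h2.mem supC
        have := h3.mem supB
        simp only [nodup_join, List.mem_cons, List.mem_append] at hn hS
        simp only [Set.mem_prod, mem_IP, Set.mem_sdiff, Set.mem_singleton_iff, h1, h2, h3]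
        grind only
      · simp at hn
      · simp at hn
    · rintro ⟨⟨m₁, m₂, m₃⟩, H, rfl⟩
      simp only [Set.mem_prod, mem_IP, Set.mem_sdiff, Set.mem_singleton_iff] at H
      simp only [nodup_join, List.mem_cons, List.mem_append, mem_IP]
      obtain ⟨⟨n1, c1, s1⟩, ⟨n2, c2, s2⟩, ⟨n3, c3, s3⟩⟩ := H
      refine ⟨?_, ch_append.2 ⟨g.impA c1, ch_append.2 ⟨g.swap.rot.impA c2, g.rot.impA c3⟩⟩, ?_⟩
      · grind only
      · grind only
  rw [key, Set.InjOn.encard_image]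
  · simp only [Set.encard_prod, mul_assoc]
  · rintro ⟨m₁, m₂, m₃⟩ h ⟨k₁, k₂, k₃⟩ h' e
    simp only [Set.mem_prod, mem_IP] at h h'
    obtain ⟨rfl, e⟩ := join_inj (by tauto) (by tauto) e
    obtain ⟨rfl, rfl⟩ := join_inj (by tauto) (by tauto) e
    rfl

/-- no path from an inner vertex of `A` ends at the common vertex of `B` and `C` -/
theorem IP_to_z (g : Glue r rA rB rC S A B C x y z) {u : α} (huB : u ∉ B) (huC : u ∉ C)
    (hB : ∃ t ∈ B, t ≠ x ∧ t ≠ z) (hC : ∃ t ∈ C, t ≠ y ∧ t ≠ z) : IP r S u z = ∅ := by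
  refine Set.eq_empty_of_forall_notMem fun m hm => ?_
  obtain ⟨e, heC, hey, hez⟩ := hC
  obtain ⟨d, hdB, hdx, hdz⟩ := hB
  obtain ⟨rel, supA, supB, supC, cover, xA, xB, xC, yA, yB, yC, zA, zB, zC, AB, AC, BC⟩ := id g
  obtain ⟨hn, hc, hS⟩ := mem_IP.1 hm
  rcases g.words hc huB huC hn.2.1 with h | ⟨m₁, m₂, rfl, h1, h2⟩ | ⟨m₁, m₂, rfl, h1, h2⟩ |
        ⟨m₁, m₂, m₃, rfl, h1, h2, h3⟩ | ⟨m₁, m₂, m₃, rfl, h1, h2, h3⟩ |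
        ⟨m₁, m₂, m₃, m₄, rfl, h1, h2, h3, h4⟩ | ⟨m₁, m₂, m₃, m₄, rfl, h1, h2, h3, h4⟩
  · exact absurd (h.mem supA).2.1 zA
  · have := h1.mem supA
    have := h2.mem supB
    have := hS e
    simp only [List.mem_cons, List.mem_append] at this
    grind only
  · have := h1.mem supA
    have := h2.mem supC
    have := hS d
    simp only [List.mem_cons, List.mem_append] at this
    grind only
  · simp at hn
  · simp at hn
  · simp at hn
  · simp at hn


/-- pairs of paths, the first ending in `B` and the second leading from `C` into `A` -/
theorem encard_pair_inner (g : Glue r rA rB rC S A B C x y z) {u v u' v' : α} (huB : u ∉ B)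
    (huC : u ∉ C) (hvA : v ∉ A) (hvC : v ∉ C) (huA' : u' ∉ A) (huB' : u' ∉ B) (hvB' : v' ∉ B)
    (hvC' : v' ∉ C) :
    (IQ r S u v u' v').encard =
      (IQ rA A u x y v').encard * ((IP rB B x v).encard * (IP rC (C \ {z}) u' y).encard +
        (IP rB (B \ {z}) x v).encard * (IP rC C u' y).encard) := by
  have key : IQ r S u v u' v' =
      (fun t : (List α × List α) × List α × List α =>
        (t.1.1 ++ x :: t.2.1, t.2.2 ++ y :: t.1.2)) ''
      (IQ rA A u x y v' ×ˢ (IP rB B x v ×ˢ IP rC (C \ {z}) u' y ∪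
        IP rB (B \ {z}) x v ×ˢ IP rC C u' y)) := by
    ext ⟨m, k⟩
    obtain ⟨rel, supA, supB, supC, cover, xA, xB, xC, yA, yB, yC, zA, zB, zC, AB, AC, BC⟩ := id g
    constructor
    · intro hm
      obtain ⟨hn, hc, hc', hS⟩ := mem_IQ.1 hm
      have hw := g.rot.rot.words hc' huA' huB' hn.2.2.2.2.1
      rcases g.words hc huB huC hn.2.2.2.1 with h | ⟨m₁, m₂, rfl, h1, h2⟩ | ⟨m₁, m₂, rfl, h1, h2⟩ |
          ⟨m₁, m₂, m₃, rfl, h1, h2, h3⟩ | ⟨m₁, m₂, m₃, rfl, h1, h2, h3⟩ |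
          ⟨m₁, m₂, m₃, m₄, rfl, h1, h2, h3, h4⟩ | ⟨m₁, m₂, m₃, m₄, rfl, h1, h2, h3, h4⟩
      · exact absurd (h.mem supA).2.1 hvA
      · rcases hw with i | ⟨k₁, k₂, rfl, i1, i2⟩ | ⟨k₁, k₂, rfl, i1, i2⟩ |
            ⟨k₁, k₂, k₃, rfl, i1, i2, i3⟩ | ⟨k₁, k₂, k₃, rfl, i1, i2, i3⟩ |
            ⟨k₁, k₂, k₃, k₄, rfl, i1, i2, i3, i4⟩ | ⟨k₁, k₂, k₃, k₄, rfl, i1, i2, i3, i4⟩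
        · exact absurd (i.mem supC).2.1 hvC'
        · refine ⟨((m₁, k₂), m₂, k₁), ?_, rfl⟩
          have := h1.mem supA
          have := h2.mem supB
          have := i1.mem supC
          have := i2.mem supA
          simp only [nodup_join, List.mem_cons, List.mem_append] at hn hS
          simp only [Set.mem_union, Set.mem_prod, mem_IP, mem_IQ, Set.mem_sdiff,
            Set.mem_singleton_iff, h1, h2, i1, i2]
          by_cases hx : z ∈ m₂
          · refine ⟨?_, Or.inl ⟨?_, ?_⟩⟩
            · grind only
            · grind only
            · grind only
          · refine ⟨?_, Or.inr ⟨?_, ?_⟩⟩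
            · grind only
            · grind only
            · grind only
        · exact absurd (i2.mem supB).2.1 hvB'
        · exact absurd (i3.mem supB).2.1 hvB'
        · simp only [List.mem_cons, List.mem_append] at hn
          grind only
        · exact absurd (i4.mem supC).2.1 hvC'
        · exact absurd (i4.mem supC).2.1 hvC'
      · exact absurd (h2.mem supC).2.1 hvC
      · exact absurd (h3.mem supC).2.1 hvC
      · rcases hw with i | ⟨k₁, k₂, rfl, i1, i2⟩ | ⟨k₁, k₂, rfl, i1, i2⟩ |
            ⟨k₁, k₂, k₃, rfl, i1, i2, i3⟩ | ⟨k₁, k₂, k₃, rfl, i1, i2, i3⟩ |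
            ⟨k₁, k₂, k₃, k₄, rfl, i1, i2, i3, i4⟩ | ⟨k₁, k₂, k₃, k₄, rfl, i1, i2, i3, i4⟩
        · exact absurd (i.mem supC).2.1 hvC'
        all_goals
          simp only [List.mem_cons, List.mem_append] at hn
          grind only
      · exact absurd (h4.mem supA).2.1 hvA
      · exact absurd (h4.mem supA).2.1 hvA
    · rintro ⟨⟨⟨m₁, k₂⟩, m₂, k₁⟩, H, e⟩
      obtain ⟨rfl, rfl⟩ := Prod.ext_iff.1 e
      simp only [Set.mem_union, Set.mem_prod, mem_IP, mem_IQ, Set.mem_sdiff,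
        Set.mem_singleton_iff] at H
      simp only [nodup_join, List.mem_cons, List.mem_append, mem_IQ]
      rcases H with ⟨⟨n1, c1, d2, s1⟩, ⟨⟨n2, c2, s2⟩, ⟨n3, d1, s3⟩⟩ |
        ⟨⟨n2, c2, s2⟩, ⟨n3, d1, s3⟩⟩⟩
      all_goals
        refine ⟨?_, ch_append.2 ⟨g.impA c1, g.rot.impA c2⟩,
          ch_append.2 ⟨g.rot.rot.impA d1, g.impA d2⟩, ?_⟩
        · grind only
        · grind only
  rw [key, Set.InjOn.encard_image, Set.encard_prod, Set.encard_union_eq]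
  · simp only [Set.encard_prod]
  · rw [Set.disjoint_left]
    rintro ⟨m₁, m₂⟩ h h'
    have := g.zB
    simp only [Set.mem_prod, mem_IP, Set.mem_sdiff, Set.mem_singleton_iff] at h h'
    grind only
  · rintro ⟨⟨m₁, m₄⟩, m₂, m₃⟩ h ⟨⟨k₁, k₄⟩, k₂, k₃⟩ h' e
    simp only [Set.mem_union, Set.mem_prod, mem_IP, mem_IQ] at h h'
    obtain ⟨e, e'⟩ := Prod.ext_iff.1 e
    obtain ⟨rfl, rfl⟩ := join_inj (by tauto) (by tauto) e
    obtain ⟨rfl, rfl⟩ := join_inj (by tauto) (by tauto) e'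
    rfl

theorem IQ_to_x (g : Glue r rA rB rC S A B C x y z) {u v u' : α} (huB : u ∉ B)
    (huC : u ∉ C) (hvA : v ∉ A) (hvC : v ∉ C) (huA' : u' ∉ A) (huB' : u' ∉ B) :
    IQ r S u v u' x = ∅ := by
  refine Set.eq_empty_of_forall_notMem ?_
  rintro ⟨m, k⟩ hm
  obtain ⟨rel, supA, supB, supC, cover, xA, xB, xC, yA, yB, yC, zA, zB, zC, AB, AC, BC⟩ := id g
  obtain ⟨hn, hc, hc', hS⟩ := mem_IQ.1 hm
  have hw := g.rot.rot.words hc' huA' huB' hn.2.2.2.2.1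
  rcases g.words hc huB huC hn.2.2.2.1 with h | ⟨m₁, m₂, rfl, h1, h2⟩ | ⟨m₁, m₂, rfl, h1, h2⟩ |
      ⟨m₁, m₂, m₃, rfl, h1, h2, h3⟩ | ⟨m₁, m₂, m₃, rfl, h1, h2, h3⟩ |
      ⟨m₁, m₂, m₃, m₄, rfl, h1, h2, h3, h4⟩ | ⟨m₁, m₂, m₃, m₄, rfl, h1, h2, h3, h4⟩
  · exact absurd (h.mem supA).2.1 hvA
  · simp at hn
  · exact absurd (h2.mem supC).2.1 hvC
  · exact absurd (h3.mem supC).2.1 hvC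
  · rcases hw with i | ⟨k₁, k₂, rfl, i1, i2⟩ | ⟨k₁, k₂, rfl, i1, i2⟩ |
        ⟨k₁, k₂, k₃, rfl, i1, i2, i3⟩ | ⟨k₁, k₂, k₃, rfl, i1, i2, i3⟩ |
        ⟨k₁, k₂, k₃, k₄, rfl, i1, i2, i3, i4⟩ | ⟨k₁, k₂, k₃, k₄, rfl, i1, i2, i3, i4⟩
    · exact absurd (i.mem supC).2.1 xC
    all_goals
      simp only [List.mem_cons, List.mem_append] at hn
      grind only
  · exact absurd (h4.mem supA).2.1 hvA
  · exact absurd (h4.mem supA).2.1 hvA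

theorem encard_pair_to_x (g : Glue r rA rB rC S A B C x y z) {u v u' : α} (huB : u ∉ B)
    (huC : u ∉ C) (hvA : v ∉ A) (hvB : v ∉ B) (huA' : u' ∉ A) (huC' : u' ∉ C) :
    (IQ r S u v u' x).encard =
      (IP rA (A \ {x}) u y).encard *
        ((IP rC C y v).encard * (IP rB (B \ {z}) u' x).encard +
         (IP rC (C \ {z}) y v).encard * (IP rB B u' x).encard) := by
  have key : IQ r S u v u' x =
      (fun t : List α × List α × List α => (t.1 ++ y :: t.2.1, t.2.2)) ''
      (IP rA (A \ {x}) u y ×ˢ (IP rC C y v ×ˢ IP rB (B \ {z}) u' x ∪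
        IP rC (C \ {z}) y v ×ˢ IP rB B u' x)) := by
    ext ⟨m, k⟩
    obtain ⟨rel, supA, supB, supC, cover, xA, xB, xC, yA, yB, yC, zA, zB, zC, AB, AC, BC⟩ := id g
    constructor
    · intro hm
      obtain ⟨hn, hc, hc', hS⟩ := mem_IQ.1 hm
      have hw := g.rot.words hc' huC' huA' hn.2.2.2.2.1
      rcases g.words hc huB huC hn.2.2.2.1 with h | ⟨m₁, m₂, rfl, h1, h2⟩ | ⟨m₁, m₂, rfl, h1, h2⟩ |
          ⟨m₁, m₂, m₃, rfl, h1, h2, h3⟩ | ⟨m₁, m₂, m₃, rfl, h1, h2, h3⟩ |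
          ⟨m₁, m₂, m₃, m₄, rfl, h1, h2, h3, h4⟩ | ⟨m₁, m₂, m₃, m₄, rfl, h1, h2, h3, h4⟩
      · exact absurd (h.mem supA).2.1 hvA
      · exact absurd (h2.mem supB).2.1 hvB
      · rcases hw with i | ⟨k₁, k₂, rfl, i1, i2⟩ | ⟨k₁, k₂, rfl, i1, i2⟩ |
            ⟨k₁, k₂, k₃, rfl, i1, i2, i3⟩ | ⟨k₁, k₂, k₃, rfl, i1, i2, i3⟩ |
            ⟨k₁, k₂, k₃, k₄, rfl, i1, i2, i3, i4⟩ | ⟨k₁, k₂, k₃, k₄, rfl, i1, i2, i3, i4⟩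
        · refine ⟨(m₁, m₂, k), ?_, rfl⟩
          have := h1.mem supA
          have := h2.mem supC
          have := i.mem supB
          simp only [nodup_join, List.mem_cons, List.mem_append] at hn hS
          simp only [Set.mem_union, Set.mem_prod, mem_IP, Set.mem_sdiff,
            Set.mem_singleton_iff, h1, h2, i]
          by_cases hx : z ∈ m₂
          · grind only
          · grind only
        · exact absurd (i2.mem supC).2.1 xC
        · simp at hn
        all_goals
          simp only [List.mem_cons, List.mem_append] at hn
          grind only
      · simp at hn
      · exact absurd (h3.mem supB).2.1 hvB
      · simp at hn
      · simp at hn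
    · rintro ⟨⟨m₁, m₂, k⟩, H, e⟩
      obtain ⟨rfl, rfl⟩ := Prod.ext_iff.1 e
      simp only [Set.mem_union, Set.mem_prod, mem_IP, Set.mem_sdiff,
        Set.mem_singleton_iff] at H
      simp only [nodup_join, List.mem_cons, List.mem_append, mem_IQ]
      rcases H with ⟨⟨n1, c1, s1⟩, ⟨⟨n2, c2, s2⟩, ⟨n3, d, s3⟩⟩ |
        ⟨⟨n2, c2, s2⟩, ⟨n3, d, s3⟩⟩⟩
      all_goals
        refine ⟨?_, ch_append.2 ⟨g.impA c1, g.rot.rot.impA c2⟩, g.rot.impA d, ?_⟩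
        · grind only
        · grind only
  rw [key, Set.InjOn.encard_image, Set.encard_prod, Set.encard_union_eq]
  · simp only [Set.encard_prod]
  · rw [Set.disjoint_left]
    rintro ⟨m₁, m₂⟩ h h'
    have := g.zB
    simp only [Set.mem_prod, mem_IP, Set.mem_sdiff, Set.mem_singleton_iff] at h h'
    grind only
  · rintro ⟨m₁, m₂, m₃⟩ h ⟨k₁, k₂, k₃⟩ h' e
    simp only [Set.mem_union, Set.mem_prod, mem_IP] at h h'
    obtain ⟨e, rfl⟩ := Prod.ext_iff.1 e
    obtain ⟨rfl, rfl⟩ := join_inj (by tauto) (by tauto) e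
    rfl

theorem encard_pair_to_z (g : Glue r rA rB rC S A B C x y z) {u v u' : α} (huB : u ∉ B)
    (huC : u ∉ C) (hvA : v ∉ A) (hvC : v ∉ C) (huA' : u' ∉ A) (huB' : u' ∉ B) :
    (IQ r S u v u' z).encard =
      (IP rB (B \ {z}) x v).encard *
        ((IP rA A u x).encard * (IP rC (C \ {y}) u' z).encard +
         (IP rA (A \ {y}) u x).encard * (IP rC C u' z).encard) := by
  have key : IQ r S u v u' z =
      (fun t : List α × List α × List α => (t.2.1 ++ x :: t.1, t.2.2)) ''
      (IP rB (B \ {z}) x v ×ˢ (IP rA A u x ×ˢ IP rC (C \ {y}) u' z ∪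
        IP rA (A \ {y}) u x ×ˢ IP rC C u' z)) := by
    ext ⟨m, k⟩
    obtain ⟨rel, supA, supB, supC, cover, xA, xB, xC, yA, yB, yC, zA, zB, zC, AB, AC, BC⟩ := id g
    constructor
    · intro hm
      obtain ⟨hn, hc, hc', hS⟩ := mem_IQ.1 hm
      have hw := g.rot.rot.words hc' huA' huB' hn.2.2.2.2.1
      rcases g.words hc huB huC hn.2.2.2.1 with h | ⟨m₁, m₂, rfl, h1, h2⟩ | ⟨m₁, m₂, rfl, h1, h2⟩ |
          ⟨m₁, m₂, m₃, rfl, h1, h2, h3⟩ | ⟨m₁, m₂, m₃, rfl, h1, h2, h3⟩ |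
          ⟨m₁, m₂, m₃, m₄, rfl, h1, h2, h3, h4⟩ | ⟨m₁, m₂, m₃, m₄, rfl, h1, h2, h3, h4⟩
      · exact absurd (h.mem supA).2.1 hvA
      · rcases hw with i | ⟨k₁, k₂, rfl, i1, i2⟩ | ⟨k₁, k₂, rfl, i1, i2⟩ |
            ⟨k₁, k₂, k₃, rfl, i1, i2, i3⟩ | ⟨k₁, k₂, k₃, rfl, i1, i2, i3⟩ |
            ⟨k₁, k₂, k₃, k₄, rfl, i1, i2, i3, i4⟩ | ⟨k₁, k₂, k₃, k₄, rfl, i1, i2, i3, i4⟩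
        · refine ⟨(m₂, m₁, k), ?_, rfl⟩
          have := h1.mem supA
          have := h2.mem supB
          have := i.mem supC
          simp only [nodup_join, List.mem_cons, List.mem_append] at hn hS
          simp only [Set.mem_union, Set.mem_prod, mem_IP, Set.mem_sdiff,
            Set.mem_singleton_iff, h1, h2, i]
          by_cases hx : y ∈ m₁
          · grind only
          · grind only
        · exact absurd (i2.mem supA).2.1 zA
        · simp at hn
        all_goals
          simp only [List.mem_cons, List.mem_append] at hn
          grind only
      · exact absurd (h2.mem supC).2.1 hvC
      · simp at hn
      · simp at hn
      · simp at hn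
      · simp at hn
    · rintro ⟨⟨m₂, m₁, k⟩, H, e⟩
      obtain ⟨rfl, rfl⟩ := Prod.ext_iff.1 e
      simp only [Set.mem_union, Set.mem_prod, mem_IP, Set.mem_sdiff,
        Set.mem_singleton_iff] at H
      simp only [nodup_join, List.mem_cons, List.mem_append, mem_IQ]
      rcases H with ⟨⟨n1, c1, s1⟩, ⟨⟨n2, c2, s2⟩, ⟨n3, d, s3⟩⟩ |
        ⟨⟨n2, c2, s2⟩, ⟨n3, d, s3⟩⟩⟩
      all_goals
        refine ⟨?_, ch_append.2 ⟨g.impA c2, g.rot.impA c1⟩, g.rot.rot.impA d, ?_⟩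
        · grind only
        · grind only
  rw [key, Set.InjOn.encard_image, Set.encard_prod, Set.encard_union_eq]
  · simp only [Set.encard_prod]
  · rw [Set.disjoint_left]
    rintro ⟨m₁, m₂⟩ h h'
    have := g.yA
    simp only [Set.mem_prod, mem_IP, Set.mem_sdiff, Set.mem_singleton_iff] at h h'
    grind only
  · rintro ⟨m₁, m₂, m₃⟩ h ⟨k₁, k₂, k₃⟩ h' e
    simp only [Set.mem_union, Set.mem_prod, mem_IP] at h h'
    obtain ⟨e, rfl⟩ := Prod.ext_iff.1 e
    obtain ⟨rfl, rfl⟩ := join_inj (by tauto) (by tauto) e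
    rfl

end Glue

end Lists

section Maps

variable {α β : Type*}

theorem chain_map {r : α → α → Prop} {s : β → β → Prop} {φ : α → β} {S : Set α}
    (h : ∀ p ∈ S, ∀ q ∈ S, r p q ↔ s (φ p) (φ q)) {u v : α} {m : List α}
    (hm : ∀ t ∈ u :: (m ++ [v]), t ∈ S) : Ch s (φ u) (m.map φ) (φ v) ↔ Ch r u m v := by
  have e : φ u :: (m.map φ ++ [φ v]) = (u :: (m ++ [v])).map φ := by simp
  rw [Ch, Ch, e, List.isChain_map]
  exact ⟨List.IsChain.imp_of_mem_imp fun p q hp hq => (h p (hm p hp) q (hm q hq)).2,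
    List.IsChain.imp_of_mem_imp fun p q hp hq => (h p (hm p hp) q (hm q hq)).1⟩

theorem mem_map_iff {φ : α → β} (hφ : φ.Injective) {S : Set α} {l : List α} :
    (∀ t, t ∈ l.map φ ↔ t ∈ φ '' S) ↔ ∀ t, t ∈ l ↔ t ∈ S := by
  constructor
  · intro h t
    simpa [hφ.eq_iff] using h (φ t)
  · intro h t
    simp [h]

theorem map_mem_IP {r : α → α → Prop} {s : β → β → Prop} {φ : α → β} (hφ : φ.Injective)
    {S : Set α} (h : ∀ p ∈ S, ∀ q ∈ S, r p q ↔ s (φ p) (φ q)) {u v : α} {m : List α} :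
    m.map φ ∈ IP s (φ '' S) (φ u) (φ v) ↔ m ∈ IP r S u v := by
  have e : φ u :: (m.map φ ++ [φ v]) = (u :: (m ++ [v])).map φ := by simp
  simp only [IP, Set.mem_ofPred_eq, e, List.nodup_map_iff hφ, mem_map_iff hφ]
  refine and_congr_right fun _ => ?_
  constructor
  · rintro ⟨h1, h2⟩
    exact ⟨(chain_map h fun t ht => (h2 t).1 ht).1 h1, h2⟩
  · rintro ⟨h1, h2⟩
    exact ⟨(chain_map h fun t ht => (h2 t).1 ht).2 h1, h2⟩

theorem encard_IP_map {r : α → α → Prop} {s : β → β → Prop} {φ : α → β} (hφ : φ.Injective)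
    {S : Set α} (h : ∀ p ∈ S, ∀ q ∈ S, r p q ↔ s (φ p) (φ q)) {u v : α} :
    (IP s (φ '' S) (φ u) (φ v)).encard = (IP r S u v).encard := by
  have key : IP s (φ '' S) (φ u) (φ v) = List.map φ '' IP r S u v := by
    ext k
    constructor
    · intro hk
      have : k ∈ Set.range (List.map φ) := by
        rw [Set.range_list_map]
        intro t ht
        obtain ⟨t, -, rfl⟩ := (hk.2.2 t).1 (by simp [ht])
        exact ⟨t, rfl⟩
      obtain ⟨m, rfl⟩ := this
      exact ⟨m, (map_mem_IP hφ h).1 hk, rfl⟩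
    · rintro ⟨m, hm, rfl⟩
      exact (map_mem_IP hφ h).2 hm
  rw [key, (List.map_injective_iff.2 hφ).encard_image]

theorem encard_IP_congr {r s : α → α → Prop} {S : Set α} (h : ∀ p ∈ S, ∀ q ∈ S, r p q ↔ s p q)
    {u v : α} : (IP s S u v).encard = (IP r S u v).encard := by
  simpa using encard_IP_map (φ := id) Function.injective_id h (u := u) (v := v)

/-- deleting a vertex `w` of `C` alone from glued graphs -/
theorem Glue.erase {r rA rB rC : α → α → Prop} {S A B C : Set α} {x y z : α}
    (g : Glue r rA rB rC S A B C x y z) {w : α} (hA : w ∉ A) (hB : w ∉ B) :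
    Glue (fun p q => r p q ∧ p ≠ w ∧ q ≠ w) rA rB (fun p q => rC p q ∧ p ≠ w ∧ q ≠ w)
      (S \ {w}) A B (C \ {w}) x y z where
  rel p q := by
    have h1 := g.rel p q
    have h2 := g.supA p q
    have h3 := g.supB p q
    grind only
  supA := g.supA
  supB := g.supB
  supC p q h := by
    have := g.supC p q h.1
    exact ⟨⟨this.1, h.2.1⟩, this.2, h.2.2⟩
  cover p := by
    have := g.cover p
    simp only [Set.mem_sdiff, Set.mem_singleton_iff]
    grind only
  xA := g.xA
  xB := g.xB
  xC h := g.xC h.1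
  yA := g.yA
  yB := g.yB
  yC := ⟨g.yC, fun h => hA (h ▸ g.yA)⟩
  zA := g.zA
  zB := g.zB
  zC := ⟨g.zC, fun h => hB (h ▸ g.zB)⟩
  AB := g.AB
  AC p hA hC := g.AC p hA hC.1
  BC p hB hC := g.BC p hB hC.1

/-- the vertices of the gasket in lattice coordinates, where `(s, t)` stands for `s • a 0 + t • b 0` -/
def LV : ℕ → Set (ℤ × ℤ)
  | 0 => {(0, 0), (1, 0), (0, 1)}
  | n + 1 => {p | p ∈ LV n ∨ p - (2 ^ n, 0) ∈ LV n ∨ p - (0, 2 ^ n) ∈ LV n}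

/-- adjacency in the gasket in lattice coordinates -/
def LA : ℕ → ℤ × ℤ → ℤ × ℤ → Prop
  | 0, p, q => p ∈ LV 0 ∧ q ∈ LV 0 ∧ p ≠ q
  | n + 1, p, q => LA n p q ∨ LA n (p - (2 ^ n, 0)) (q - (2 ^ n, 0)) ∨
      LA n (p - (0, 2 ^ n)) (q - (0, 2 ^ n))

theorem LA_sup (n : ℕ) : ∀ p q, LA n p q → p ∈ LV n ∧ q ∈ LV n := by
  induction n with
  | zero => exact fun p q h => ⟨h.1, h.2.1⟩
  | succ n ih =>
    rintro p q (h | h | h)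
    · exact ⟨Or.inl (ih _ _ h).1, Or.inl (ih _ _ h).2⟩
    · exact ⟨Or.inr (Or.inl (ih _ _ h).1), Or.inr (Or.inl (ih _ _ h).2)⟩
    · exact ⟨Or.inr (Or.inr (ih _ _ h).1), Or.inr (Or.inr (ih _ _ h).2)⟩

theorem LV_bound (n : ℕ) : ∀ p ∈ LV n, 0 ≤ p.1 ∧ 0 ≤ p.2 ∧ p.1 + p.2 ≤ 2 ^ n := by
  induction n with
  | zero => rintro p (rfl | rfl | rfl) <;> simp
  | succ n ih =>
    rintro p (h | h | h) <;> have := ih _ h <;> have := pow_succ (2 : ℤ) n <;> simp at * <;> omega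

theorem corner_mem (n : ℕ) : (0, 0) ∈ LV n ∧ (2 ^ n, 0) ∈ LV n ∧ (0, 2 ^ n) ∈ LV n := by
  induction n with
  | zero => simp [LV]
  | succ n ih =>
    refine ⟨Or.inl ih.1, Or.inr (Or.inl ?_), Or.inr (Or.inr ?_)⟩
    · convert ih.2.1 using 1; ext <;> simp; ring
    · convert ih.2.2 using 1; ext <;> simp; ring

theorem LV_swap (n : ℕ) : ∀ p, p.swap ∈ LV n ↔ p ∈ LV n := by
  induction n with
  | zero => rintro ⟨i, j⟩; simp [LV]; tauto
  | succ n ih =>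
    rintro ⟨i, j⟩
    simp only [LV, Set.mem_ofPred_eq]
    rw [ih, ← ih (_ - (2 ^ n, 0)), ← ih (_ - (0, 2 ^ n))]
    simp
    tauto

theorem LA_swap (n : ℕ) : ∀ p q, LA n p.swap q.swap ↔ LA n p q := by
  induction n with
  | zero => intro p q; simp only [LA, LV_swap, ne_eq, Prod.swap_inj]
  | succ n ih =>
    rintro ⟨i, j⟩ ⟨k, l⟩
    simp only [LA]
    rw [ih, ← ih (_ - (2 ^ n, 0)), ← ih (_ - (0, 2 ^ n))]
    simp
    tauto

/-- rotation of the triangle with corners `(0, 0)`, `(2 ^ n, 0)`, `(0, 2 ^ n)` -/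
def rho (n : ℕ) (p : ℤ × ℤ) : ℤ × ℤ := (2 ^ n - p.1 - p.2, p.1)

theorem LV_rho (n : ℕ) : ∀ p, rho n p ∈ LV n ↔ p ∈ LV n := by
  induction n with
  | zero => rintro ⟨i, j⟩; simp [LV, rho]; omega
  | succ n ih =>
    intro p
    have h1 : rho (n + 1) p = rho n p + (2 ^ n, 0) := by ext <;> simp [rho]; ring
    have h2 : rho (n + 1) p = rho n (p - (2 ^ n, 0)) + (0, 2 ^ n) := by ext <;> simp [rho]; ring
    have h3 : rho (n + 1) p = rho n (p - (0, 2 ^ n)) := by ext <;> simp [rho]; ring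
    simp only [LV, Set.mem_ofPred_eq]
    rw [show rho (n + 1) p - (2 ^ n, 0) = rho n p by rw [h1, add_sub_cancel_right],
      show rho (n + 1) p - (0, 2 ^ n) = rho n (p - (2 ^ n, 0)) by rw [h2, add_sub_cancel_right],
      h3, ih, ih, ih]
    tauto

theorem rho_injective (n : ℕ) : (rho n).Injective := by
  intro p q h
  simp only [rho, Prod.mk.injEq] at h
  ext <;> omega

theorem LA_rho (n : ℕ) : ∀ p q, LA n (rho n p) (rho n q) ↔ LA n p q := by
  induction n with
  | zero => intro p q; simp only [LA, LV_rho, ne_eq, (rho_injective 0).eq_iff]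
  | succ n ih =>
    have h1 p : rho (n + 1) p - (2 ^ n, 0) = rho n p := by ext <;> simp [rho]; ring
    have h2 p : rho (n + 1) p - (0, 2 ^ n) = rho n (p - (2 ^ n, 0)) := by
      ext <;> simp [rho]; ring
    have h3 p : rho (n + 1) p = rho n (p - (0, 2 ^ n)) := by ext <;> simp [rho]; ring
    intro p q
    simp only [LA]
    rw [h1, h1, h2, h2, h3, h3, ih, ih, ih]
    tauto

theorem image_LV_swap (n : ℕ) : Prod.swap '' LV n = LV n := by
  ext p
  rw [Set.image_swap_eq_preimage_swap]
  exact LV_swap n p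

theorem image_LV_rho (n : ℕ) : rho n '' LV n = LV n := by
  ext p
  constructor
  · rintro ⟨q, hq, rfl⟩
    exact (LV_rho n q).2 hq
  · intro hp
    have : rho n (p.2, 2 ^ n - p.1 - p.2) = p := by ext <;> simp [rho]
    exact ⟨_, (LV_rho n _).1 (this.symm ▸ hp), this⟩

theorem encard_swap (n : ℕ) (u v : ℤ × ℤ) :
    (IP (LA n) (LV n) u.swap v.swap).encard = (IP (LA n) (LV n) u v).encard := by
  conv_lhs => rw [← image_LV_swap]
  exact encard_IP_map Prod.swap_injective fun p _ q _ => (LA_swap n p q).symm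

theorem encard_rho (n : ℕ) (u v : ℤ × ℤ) :
    (IP (LA n) (LV n) (rho n u) (rho n v)).encard = (IP (LA n) (LV n) u v).encard := by
  conv_lhs => rw [← image_LV_rho]
  exact encard_IP_map (rho_injective n) fun p _ q _ => (LA_rho n p q).symm

theorem encard_swap_erase (n : ℕ) (u v w : ℤ × ℤ) :
    (IP (LA n) (LV n \ {w.swap}) u.swap v.swap).encard =
      (IP (LA n) (LV n \ {w}) u v).encard := by
  conv_lhs => rw [← image_LV_swap, ← Set.image_singleton, ← Set.image_sdiff Prod.swap_injective]
  exact encard_IP_map Prod.swap_injective fun p _ q _ => (LA_swap n p q).symm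

theorem encard_rho_erase (n : ℕ) (u v w : ℤ × ℤ) :
    (IP (LA n) (LV n \ {rho n w}) (rho n u) (rho n v)).encard =
      (IP (LA n) (LV n \ {w}) u v).encard := by
  conv_lhs => rw [← image_LV_rho, ← Set.image_singleton, ← Set.image_sdiff (rho_injective n)]
  exact encard_IP_map (rho_injective n) fun p _ q _ => (LA_rho n p q).symm

/-- the number of Hamiltonian paths between two corners of the gasket -/
noncomputable def cp (n : ℕ) : ℕ∞ := (IP (LA n) (LV n) (0, 0) (2 ^ n, 0)).encard

/-- the number of paths between two corners visiting every vertex but the third corner -/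
noncomputable def cd (n : ℕ) : ℕ∞ :=
  (IP (LA n) (LV n \ {(0, 2 ^ n)}) (0, 0) (2 ^ n, 0)).encard

/-- the corners of the gasket in lattice coordinates -/
def Corner (n : ℕ) (p : ℤ × ℤ) : Prop := p = (0, 0) ∨ p = (2 ^ n, 0) ∨ p = (0, 2 ^ n)

theorem encard_corner {n : ℕ} {u v : ℤ × ℤ} (hu : Corner n u) (hv : Corner n v) (h : u ≠ v) :
    (IP (LA n) (LV n) u v).encard = cp n := by
  have h1 := encard_rho n (0, 0) (2 ^ n, 0)
  have h2 := encard_rho n (2 ^ n, 0) (0, 2 ^ n)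
  have h3 := encard_swap n (0, 0) (2 ^ n, 0)
  have h4 := encard_swap n (2 ^ n, 0) (0, 2 ^ n)
  have h5 := encard_swap n (0, 2 ^ n) (0, 0)
  simp only [rho, Prod.swap, sub_zero, sub_self] at h1 h2 h3 h4 h5
  rcases hu with rfl | rfl | rfl <;> rcases hv with rfl | rfl | rfl <;>
    simp_all [cp]

theorem encard_corner_erase {n : ℕ} {u v w : ℤ × ℤ} (hu : Corner n u) (hv : Corner n v)
    (hw : Corner n w) (h : u ≠ v) (hu' : w ≠ u) (hv' : w ≠ v) :
    (IP (LA n) (LV n \ {w}) u v).encard = cd n := by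
  have h1 := encard_rho_erase n (0, 0) (2 ^ n, 0) (0, 2 ^ n)
  have h2 := encard_rho_erase n (2 ^ n, 0) (0, 2 ^ n) (0, 0)
  have h3 := encard_swap_erase n (0, 0) (2 ^ n, 0) (0, 2 ^ n)
  have h4 := encard_swap_erase n (2 ^ n, 0) (0, 2 ^ n) (0, 0)
  have h5 := encard_swap_erase n (0, 2 ^ n) (0, 0) (2 ^ n, 0)
  simp only [rho, Prod.swap, sub_zero, sub_self] at h1 h2 h3 h4 h5
  rcases hu with rfl | rfl | rfl <;> rcases hv with rfl | rfl | rfl <;>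
    rcases hw with rfl | rfl | rfl <;> simp_all [cd]

end Maps

theorem glue (n : ℕ) : Glue (LA (n + 1)) (LA n)
    (fun p q => LA n (p - (2 ^ n, 0)) (q - (2 ^ n, 0)))
    (fun p q => LA n (p - (0, 2 ^ n)) (q - (0, 2 ^ n)))
    (LV (n + 1)) (LV n) {p | p - (2 ^ n, 0) ∈ LV n} {p | p - (0, 2 ^ n) ∈ LV n}
    (2 ^ n, 0) (0, 2 ^ n) (2 ^ n, 2 ^ n) := by
  have hb := LV_bound n
  obtain ⟨h0, h1, h2⟩ := corner_mem n
  have h0' : (0 : ℤ × ℤ) ∈ LV n := h0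
  have hn : (0 : ℤ) < 2 ^ n := by positivity
  have hxC : ((2 : ℤ) ^ n, (0 : ℤ)) - (0, 2 ^ n) ∉ LV n := fun h => by
    have := hb _ h
    simp at this
    omega
  have hyB : ((0 : ℤ), (2 : ℤ) ^ n) - (2 ^ n, 0) ∉ LV n := fun h => by
    have := hb _ h
    simp at this
    omega
  have hzA : ((2 : ℤ) ^ n, (2 : ℤ) ^ n) ∉ LV n := fun h => by
    have := hb _ h
    simp at this
    omega
  refine ⟨fun _ _ => Iff.rfl, LA_sup n, fun _ _ => LA_sup n _ _, fun _ _ => LA_sup n _ _,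
    fun _ => Iff.rfl, h1, by simpa using h0', hxC, h2, hyB, by simpa using h0', hzA,
    by simpa using h2, by simpa using h1, ?_, ?_, ?_⟩
  all_goals
    intro p h h'
    have := hb _ h
    have := hb _ h'
    simp at *
    ext <;> simp <;> omega

theorem encard_shift (n : ℕ) (s u v : ℤ × ℤ) :
    (IP (fun p q => LA n (p - s) (q - s)) {p | p - s ∈ LV n} u v).encard =
      (IP (LA n) (LV n) (u - s) (v - s)).encard := by
  rw [← encard_IP_map (sub_left_injective (b := s)) (S := {p | p - s ∈ LV n})
    (r := fun p q => LA n (p - s) (q - s)) (fun _ _ _ _ => Iff.rfl)]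
  congr
  exact Set.image_preimage_eq (LV n) fun p => ⟨p + s, by simp⟩

theorem encard_shift_erase (n : ℕ) (s u v w : ℤ × ℤ) :
    (IP (fun p q => LA n (p - s) (q - s)) ({p | p - s ∈ LV n} \ {w}) u v).encard =
      (IP (LA n) (LV n \ {w - s}) (u - s) (v - s)).encard := by
  rw [← encard_IP_map (sub_left_injective (b := s)) (S := {p | p - s ∈ LV n} \ {w})
    (r := fun p q => LA n (p - s) (q - s)) (fun _ _ _ _ => Iff.rfl),
    Set.image_sdiff sub_left_injective, Set.image_singleton]
  congr
  exact Set.image_preimage_eq (LV n) fun p => ⟨p + s, by simp⟩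

theorem shift_corner {n : ℕ} {s u v : ℤ × ℤ} (hu : Corner n (u - s)) (hv : Corner n (v - s))
    (h : u ≠ v) :
    (IP (fun p q => LA n (p - s) (q - s)) {p | p - s ∈ LV n} u v).encard = cp n := by
  rw [encard_shift, encard_corner hu hv (by simpa using h)]

theorem shift_corner_erase {n : ℕ} {s u v w : ℤ × ℤ} (hu : Corner n (u - s))
    (hv : Corner n (v - s)) (hw : Corner n (w - s)) (h : u ≠ v) (hu' : w ≠ u) (hv' : w ≠ v) :
    (IP (fun p q => LA n (p - s) (q - s)) ({p | p - s ∈ LV n} \ {w}) u v).encard = cd n := by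
  rw [encard_shift_erase, encard_corner_erase hu hv hw (by simpa using h) (by simpa using hu')
    (by simpa using hv')]

theorem not_mem_of_lt {n : ℕ} {p : ℤ × ℤ} (h : p.1 < 0 ∨ p.2 < 0 ∨ 2 ^ n < p.1 + p.2) :
    p ∉ LV n := fun hp => by
  have := LV_bound n p hp
  omega

theorem cp_succ (n : ℕ) : cp (n + 1) = 2 * cp n ^ 2 * cd n := by
  have h0 : (0 : ℤ) < 2 ^ n := by positivity
  rw [cp, (glue n).encard_cross, encard_corner, encard_corner_erase, shift_corner, shift_corner,
    shift_corner_erase]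
  · ring
  case hC => exact ⟨(0, 2 ^ n + 2 ^ n), by simpa using (corner_mem n).2.2, by simp, by simp⟩
  all_goals
    first
    | (simp [Corner, Prod.ext_iff]; done)
    | (simp [Corner, Prod.ext_iff]; omega)
    | (refine not_mem_of_lt ?_; simp; done)
    | (refine not_mem_of_lt ?_; simp; omega)

theorem encard_inner_x (n : ℕ) :
    (IP (LA (n + 1)) (LV (n + 1)) (0, 0) (2 ^ n, 0)).encard = cp n ^ 2 * cd n := by
  have h0 : (0 : ℤ) < 2 ^ n := by positivity
  rw [(glue n).encard_to_x, encard_corner_erase, shift_corner, shift_corner]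
  · ring
  all_goals
    first
    | (simp [Corner, Prod.ext_iff]; done)
    | (simp [Prod.ext_iff]; omega)
    | (refine not_mem_of_lt ?_; simp)

theorem encard_inner_z (n : ℕ) :
    (IP (LA (n + 1)) (LV (n + 1)) (0, 0) (2 ^ n, 2 ^ n)).encard = 0 := by
  have h0 : (0 : ℤ) < 2 ^ n := by positivity
  rw [(glue n).IP_to_z, Set.encard_empty]
  case hB => exact ⟨(2 ^ n + 2 ^ n, 0), by simpa using (corner_mem n).2.1, by simp, by simp⟩
  case hC => exact ⟨(0, 2 ^ n + 2 ^ n), by simpa using (corner_mem n).2.2, by simp, by simp⟩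
  all_goals
    first
    | (simp; done)
    | (refine not_mem_of_lt ?_; simp)

/-- the number of spanning pairs of disjoint paths from `(0, 0)` to one of the other two corners
and from the remaining corner to `e` -/
noncomputable def cq (n : ℕ) (e : ℤ × ℤ) : ℕ∞ :=
  (IQ (LA n) (LV n) (0, 0) (2 ^ n, 0) (0, 2 ^ n) e).encard +
    (IQ (LA n) (LV n) (0, 0) (0, 2 ^ n) (2 ^ n, 0) e).encard

theorem encard_inner_of_lt (n : ℕ) {e : ℤ × ℤ} (he : e.1 < 2 ^ n) (he' : e.2 < 2 ^ n) :
    (IP (LA (n + 1)) (LV (n + 1)) (0, 0) e).encard = cp n ^ 2 * cq n e := by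
  have h0 : (0 : ℤ) < 2 ^ n := by positivity
  rw [(glue n).encard_inner, shift_corner, shift_corner, shift_corner, shift_corner, cq]
  · ring
  all_goals
    first
    | (simp [Corner, Prod.ext_iff]; done)
    | (simp [Prod.ext_iff]; omega)
    | (refine not_mem_of_lt ?_; simp; done)
    | (refine not_mem_of_lt ?_; simp; omega)

theorem cq_succ (n : ℕ) {e : ℤ × ℤ} (he : e.1 < 2 ^ n) (he' : e.2 < 2 ^ n) :
    cq (n + 1) e = 2 * cp n * cd n * cq n e := by
  have h0 : (0 : ℤ) < 2 ^ n := by positivity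
  rw [cq, (glue n).encard_pair_inner, (glue n).swap.encard_pair_inner, shift_corner, shift_corner,
    shift_corner, shift_corner, shift_corner_erase, shift_corner_erase, shift_corner_erase,
    shift_corner_erase, cq]
  · ring
  all_goals
    first
    | (simp [Corner, Prod.ext_iff]; done)
    | (simp [Corner, Prod.ext_iff]; omega)
    | (refine not_mem_of_lt ?_; simp; done)
    | (refine not_mem_of_lt ?_; simp; omega)

theorem cq_x (n : ℕ) : cq (n + 1) (2 ^ n, 0) = 2 * cd n ^ 2 * cp n := by
  have h0 : (0 : ℤ) < 2 ^ n := by positivity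
  rw [cq, (glue n).IQ_to_x, (glue n).encard_pair_to_x, encard_corner_erase, shift_corner,
    shift_corner, shift_corner_erase, shift_corner_erase, Set.encard_empty]
  · ring
  all_goals
    first
    | (simp [Corner, Prod.ext_iff]; done)
    | (simp [Corner, Prod.ext_iff]; omega)
    | (refine not_mem_of_lt ?_; simp; done)
    | (refine not_mem_of_lt ?_; simp; omega)

theorem cq_z (n : ℕ) : cq (n + 1) (2 ^ n, 2 ^ n) = 4 * cd n ^ 2 * cp n := by
  have h0 : (0 : ℤ) < 2 ^ n := by positivity
  rw [cq, (glue n).encard_pair_to_z, (glue n).swap.encard_pair_to_z, shift_corner_erase,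
    shift_corner_erase, shift_corner_erase, shift_corner_erase, shift_corner, shift_corner,
    encard_corner, encard_corner, encard_corner_erase, encard_corner_erase]
  · ring
  all_goals
    first
    | (simp [Corner, Prod.ext_iff]; done)
    | (simp [Corner, Prod.ext_iff]; omega)
    | (refine not_mem_of_lt ?_; simp; done)
    | (refine not_mem_of_lt ?_; simp; omega)

theorem cd_succ (n : ℕ) (hn : 1 ≤ n) : cd (n + 1) = 2 * cp n * cd n ^ 2 := by
  obtain ⟨n, rfl⟩ := Nat.exists_eq_add_of_le' hn
  set k := n + 1 with hk
  have h0 : (0 : ℤ) < 2 ^ n := by positivity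
  have h1 : (0 : ℤ) < 2 ^ k := by positivity
  have h2 : (2 : ℤ) ^ k = 2 * 2 ^ n := by rw [hk]; ring
  have g := (glue k).erase (w := (0, 2 ^ (k + 1))) (not_mem_of_lt (by simp; omega))
    (not_mem_of_lt (by simp))
  have hc : (IP (fun p q => LA k (p - (0, 2 ^ k)) (q - (0, 2 ^ k)) ∧
        p ≠ (0, 2 ^ (k + 1)) ∧ q ≠ (0, 2 ^ (k + 1)))
      ({p | p - (0, 2 ^ k) ∈ LV k} \ {(0, 2 ^ (k + 1))}) (0, 2 ^ k) (2 ^ k, 2 ^ k)).encard =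
      cd k := by
    rw [encard_IP_congr (r := fun p q => LA k (p - (0, 2 ^ k)) (q - (0, 2 ^ k)))
      fun p hp q hq => ⟨fun h => ⟨h, hp.2, hq.2⟩, And.left⟩, shift_corner_erase]
    all_goals
      simp [Corner, Prod.ext_iff]
      try omega
  rw [cd, encard_IP_congr (s := LA (k + 1))
    (r := fun p q => LA (k + 1) p q ∧ p ≠ (0, 2 ^ (k + 1)) ∧ q ≠ (0, 2 ^ (k + 1)))
    (fun p hp q hq => ⟨And.left, fun h => ⟨h, hp.2, hq.2⟩⟩), g.encard_cross, hc, encard_corner,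
    encard_corner_erase, shift_corner, shift_corner_erase]
  · ring
  case hC =>
    refine ⟨(2 ^ n, 2 ^ k), ⟨?_, ?_⟩, ?_, ?_⟩
    · have := (corner_mem n).2.1
      have : ((2 : ℤ) ^ n, (0 : ℤ)) ∈ LV k := Or.inl this
      simpa using this
    all_goals
      simp [Prod.ext_iff]
      try omega
  case huC | hvC =>
    refine fun h => not_mem_of_lt (n := k) ?_ h.1
    simp
    try omega
  all_goals
    first
    | (simp [Corner, Prod.ext_iff]; done)
    | (simp [Corner, Prod.ext_iff]; omega)
    | (refine not_mem_of_lt ?_; simp; done)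
    | (refine not_mem_of_lt ?_; simp; omega)

theorem mem_IP_iff_perm {α : Type*} {r : α → α → Prop} {S : Set α} {u v : α} {l m : List α}
    (hl : (u :: (l ++ [v])).Nodup) (hS : ∀ t, t ∈ u :: (l ++ [v]) ↔ t ∈ S) :
    m ∈ IP r S u v ↔ m.Perm l ∧ Ch r u m v := by
  have key : (u :: (m ++ [v])).Perm (u :: (l ++ [v])) ↔ m.Perm l := by
    rw [List.perm_cons, List.perm_append_right_iff]
  rw [← key]
  constructor
  · rintro ⟨h1, h2, h3⟩
    exact ⟨(List.perm_ext_iff_of_nodup h1 hl).2 fun t => (h3 t).trans (hS t).symm, h2⟩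
  · rintro ⟨h1, h2⟩
    exact ⟨h1.nodup_iff.2 hl, h2, fun t => h1.mem_iff.trans (hS t)⟩

theorem cp_zero : cp 0 = 1 := by
  have : IP (LA 0) (LV 0) (0, 0) (2 ^ 0, 0) = {[(0, 1)]} := by
    ext m
    rw [mem_IP_iff_perm (l := [(0, 1)]) (by simp [Prod.ext_iff]) (by simp [LV]; tauto),
      List.perm_singleton, Set.mem_singleton_iff, and_iff_left_iff_imp]
    rintro rfl
    simp [Ch, LA, LV, Prod.ext_iff]
  rw [cp, this, Set.encard_singleton]

theorem cd_zero : cd 0 = 1 := by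
  have : IP (LA 0) (LV 0 \ {(0, 2 ^ 0)}) (0, 0) (2 ^ 0, 0) = {[]} := by
    ext m
    rw [mem_IP_iff_perm (l := []) (by simp [Prod.ext_iff]) (by simp [LV]; grind),
      List.perm_nil, Set.mem_singleton_iff, and_iff_left_iff_imp]
    rintro rfl
    simp [Ch, LA, LV, Prod.ext_iff]
  rw [cd, this, Set.encard_singleton]

theorem cd_one : cd 1 = 3 := by
  have : IP (LA 1) (LV 1 \ {(0, 2 ^ 1)}) (0, 0) (2 ^ 1, 0) =
      {[(1, 0), (0, 1), (1, 1)], [(0, 1), (1, 0), (1, 1)], [(0, 1), (1, 1), (1, 0)]} := by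
    ext m
    rw [mem_IP_iff_perm (l := [(1, 0), (0, 1), (1, 1)]) (by simp [Prod.ext_iff])
      (by rintro ⟨i, j⟩; simp [LV, Prod.ext_iff]; grind), ← List.mem_permutations']
    simp only [List.permutations', List.permutations'Aux, List.flatMap_cons, List.flatMap_nil,
      List.map_cons, List.map_nil, List.append_nil, List.cons_append, List.nil_append,
      Set.mem_insert_iff, Set.mem_singleton_iff, List.mem_cons, List.not_mem_nil, or_false]
    constructor
    · rintro ⟨rfl | rfl | rfl | rfl | rfl | rfl, h⟩ <;> simp [Ch, LA, LV, Prod.ext_iff] at h ⊢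
    · rintro (rfl | rfl | rfl) <;> simp [Ch, LA, LV, Prod.ext_iff]
  rw [cd, this, Set.encard_insert_of_notMem (by simp), Set.encard_pair (by simp)]
  norm_num

theorem cp_cd_ne (n : ℕ) : (cp n ≠ 0 ∧ cp n ≠ ⊤) ∧ cd n ≠ 0 ∧ cd n ≠ ⊤ := by
  induction n with
  | zero => simp [cp_zero, cd_zero]
  | succ n ih =>
    obtain ⟨⟨h1, h2⟩, h3, h4⟩ := ih
    obtain ⟨p, hp⟩ := ENat.ne_top_iff_exists.1 h2
    obtain ⟨d, hd⟩ := ENat.ne_top_iff_exists.1 h4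
    refine ⟨?_, ?_⟩
    · rw [cp_succ]
      exact ⟨by simp [h1, h3], by rw [← hp, ← hd]; exact ENat.natCast_ne_top (2 * p ^ 2 * d)⟩
    · rcases Nat.eq_zero_or_pos n with rfl | hn
      · simp [cd_one]
      · rw [cd_succ n hn]
        exact ⟨by simp [h1, h3], by rw [← hp, ← hd]; exact ENat.natCast_ne_top (2 * p * d ^ 2)⟩

theorem mul_cq {K L : ℕ∞} {m n : ℕ} {e : ℤ × ℤ} (he : e.1 < 2 ^ m) (he' : e.2 < 2 ^ m)
    (hm : 1 ≤ m) (h : K * cq m e = L * cd m) (hn : m ≤ n) : K * cq n e = L * cd n := by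
  induction n, hn using Nat.le_induction with
  | base => exact h
  | succ n hn ih =>
    have hp : (2 : ℤ) ^ m ≤ 2 ^ n := pow_le_pow_right₀ (by norm_num) hn
    rw [cq_succ n (he.trans_le hp) (he'.trans_le hp), cd_succ n (hm.trans hn),
      show K * (2 * cp n * cd n * cq n e) = 2 * cp n * cd n * (K * cq n e) by ring, ih]
    ring

theorem mul_encard_inner {K L : ℕ∞} {m n : ℕ} {e : ℤ × ℤ} (he : e.1 < 2 ^ m) (he' : e.2 < 2 ^ m)
    (hm : 1 ≤ m) (h : K * cq m e = L * cd m) (hn : m < n) :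
    2 * K * (IP (LA n) (LV n) (0, 0) e).encard = L * cp n := by
  obtain ⟨n, rfl⟩ := Nat.exists_eq_add_of_le' (Nat.one_le_of_lt hn)
  have hn := Nat.le_of_lt_succ hn
  have hp : (2 : ℤ) ^ m ≤ 2 ^ n := pow_le_pow_right₀ (by norm_num) hn
  rw [encard_inner_of_lt n (he.trans_le hp) (he'.trans_le hp), cp_succ,
    show 2 * K * (cp n ^ 2 * cq n e) = 2 * cp n ^ 2 * (K * cq n e) by ring,
    mul_cq he he' hm h hn]
  ring

/-- the vertex of the gasket with lattice coordinates `t` -/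
def pt (t : ℤ × ℤ) : ℝ × ℝ := (t.1 + t.2 / 2, t.2 / 2 * sq3)

theorem pt_injective : pt.Injective := by
  rintro ⟨i, j⟩ ⟨k, l⟩ h
  have h3 : sq3 ≠ 0 := by simp [sq3]
  simp only [pt, Prod.mk.injEq, mul_eq_mul_right_iff, h3, or_false] at h
  have hj : (j : ℝ) = l := by linarith
  have hi : (i : ℝ) = k := by linarith
  exact Prod.ext (mod_cast hi) (mod_cast hj)

theorem pt_a (m : ℕ) : pt (2 ^ m, 0) = a m := by simp [pt, a]

theorem pt_b (m : ℕ) : pt (0, 2 ^ m) = b m := by simp [pt, b]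

theorem pt_c (m : ℕ) : pt (2 ^ m, 2 ^ m) = c m := by
  simp [pt, c]
  ring

theorem pt_o : pt (0, 0) = o := by simp [pt, o]

theorem pt_sub (s t : ℤ × ℤ) : pt (s - t) = pt s - pt t := by
  ext <;> simp [pt] <;> ring

theorem image_pt_LV (n : ℕ) : pt '' LV n = V n := by
  induction n with
  | zero =>
    have h1 := pt_a 0
    have h2 := pt_b 0
    simp only [pow_zero] at h1 h2
    simp only [LV, V, Set.image_insert_eq, Set.image_singleton, h1, h2, pt_o]
  | succ n ih =>
    have key (s : ℤ × ℤ) : pt '' {t | t - s ∈ LV n} = (· + pt s) '' (pt '' LV n) := by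
      ext u
      simp only [Set.mem_image]
      constructor
      · rintro ⟨t, ht, rfl⟩
        exact ⟨_, ⟨_, ht, rfl⟩, by rw [pt_sub, sub_add_cancel]⟩
      · rintro ⟨_, ⟨t, ht, rfl⟩, rfl⟩
        refine ⟨t + s, by simpa using ht, ?_⟩
        have := pt_sub (t + s) s
        rw [add_sub_cancel_right] at this
        rw [this, sub_add_cancel]
    have : LV (n + 1) = LV n ∪ {t | t - (2 ^ n, 0) ∈ LV n} ∪ {t | t - (0, 2 ^ n) ∈ LV n} := by
      ext t
      simp only [LV, Set.mem_union, Set.mem_ofPred_eq, or_assoc]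
    rw [this, Set.image_union, Set.image_union, key, key, ih, pt_a, pt_b, V]

theorem mem_shift {s : Set (Sym2 (ℝ × ℝ))} {t u v : ℝ × ℝ} :
    s(u, v) ∈ Sym2.map (· + t) '' s ↔ s(u - t, v - t) ∈ s := by
  constructor
  · rintro ⟨e, he, h⟩
    induction e with
    | _ x y =>
      have : s(x, y) = s(u - t, v - t) := by
        apply Sym2.map.injective (add_left_injective t)
        simpa using h
      exact this ▸ he
  · exact fun h => ⟨_, h, by simp⟩

theorem mem_E_iff (n : ℕ) : ∀ s t, s(pt s, pt t) ∈ E n ↔ LA n s t := by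
  induction n with
  | zero =>
    intro s t
    have h1 := pt_a 0
    have h2 := pt_b 0
    simp only [pow_zero] at h1 h2
    simp only [E, ← pt_o, ← h1, ← h2, Set.mem_insert_iff, Set.mem_singleton_iff, Sym2.eq_iff,
      pt_injective.eq_iff, LA, LV]
    grind
  | succ n ih =>
    intro s t
    rw [E, Set.mem_union, Set.mem_union, mem_shift, mem_shift, ← pt_a, ← pt_b, ← pt_sub, ← pt_sub,
      ← pt_sub, ← pt_sub, ih, ih, ih, LA, or_assoc]

theorem LA_irrefl (n : ℕ) : ∀ s, ¬LA n s s := by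
  induction n with
  | zero => exact fun s h => h.2.2 rfl
  | succ n ih =>
    rintro s (h | h | h) <;> exact ih _ h

theorem adj_pt (n : ℕ) (s t : ℤ × ℤ) : LA n s t ↔ (G n).Adj (pt s) (pt t) := by
  rw [G, SimpleGraph.fromEdgeSet_adj, mem_E_iff, pt_injective.ne_iff]
  exact ⟨fun h => ⟨h, fun e => LA_irrefl n t (e ▸ h)⟩, And.left⟩

theorem support_split {W : Type*} {Γ : SimpleGraph W} {u v : W} (w : Γ.Walk u v) (h : u ≠ v) :
    w.support = u :: (w.support.tail.dropLast ++ [v]) := by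
  have h1 : w.support.tail ≠ [] := by
    cases w with
    | nil => exact absurd rfl h
    | cons _ w => simp
  have h2 : w.support.tail.getLast h1 = v := by
    rw [List.getLast_tail, SimpleGraph.Walk.getLast_support]
  conv_lhs => rw [← SimpleGraph.Walk.cons_tail_support, ← List.dropLast_append_getLast h1, h2]

theorem f_eq {n : ℕ} {u v : ℝ × ℝ} (h : u ≠ v) :
    f n u v = (IP (G n).Adj (V n) u v).encard.toNat := by
  rw [f, ← Set.ncard_def, ← Nat.card_coe_set_eq]
  refine Nat.card_congr (Equiv.ofBijective
    (fun w => ⟨w.1.support.tail.dropLast, ?_, ?_, ?_⟩) ⟨?_, ?_⟩)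
  · rw [← support_split w.1 h]
    exact w.2.1.support_nodup
  · rw [Ch, ← support_split w.1 h]
    exact w.1.isChain_adj_support
  · rw [← support_split w.1 h]
    exact w.2.2
  · rintro ⟨w, hw⟩ ⟨w', hw'⟩ e
    have e : w.support.tail.dropLast = w'.support.tail.dropLast := congrArg Subtype.val e
    refine Subtype.ext (SimpleGraph.Walk.ext_support ?_)
    rw [support_split w h, support_split w' h, e]
  · rintro ⟨m, h1, h2, h3⟩
    obtain ⟨w, hs⟩ : ∃ w : (G n).Walk u v, w.support = u :: (m ++ [v]) :=
      ⟨(SimpleGraph.Walk.ofSupport _ (List.cons_ne_nil u (m ++ [v])) h2).copy (by simp) (by simp),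
        (SimpleGraph.Walk.support_copy ..).trans (SimpleGraph.Walk.support_ofSupport _ h2)⟩
    refine ⟨⟨w, ?_, ?_⟩, ?_⟩
    · rw [SimpleGraph.Walk.isPath_def, hs]
      exact h1
    · rw [hs]
      exact h3
    · simp only [hs, List.tail_cons, List.dropLast_concat]

theorem f_pt (n : ℕ) {e : ℤ × ℤ} (he : e ≠ (0, 0)) :
    f n o (pt e) = (IP (LA n) (LV n) (0, 0) e).encard.toNat := by
  rw [← pt_o, f_eq (pt_injective.ne he.symm), ← image_pt_LV,
    encard_IP_map pt_injective fun s _ t _ => adj_pt n s t]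

theorem F_eq_div {n K L : ℕ} {e : ℤ × ℤ} (he : e ≠ (0, 0)) (hK : K ≠ 0)
    (h : K * (IP (LA n) (LV n) (0, 0) e).encard = L * cp n) : F n (pt e) = L / K := by
  have h1 : f1 n = (cp n).toNat := by
    rw [f1, ← pt_a, f_pt n (by simp [Prod.ext_iff]), cp]
  have h2 : K * f n o (pt e) = L * f1 n := by
    rw [h1, f_pt n he]
    simpa using congrArg ENat.toNat h
  have h3 : f1 n ≠ 0 := by
    rw [h1, ne_eq, ENat.toNat_eq_zero, not_or]
    exact (cp_cd_ne n).1
  rw [F, div_eq_div_iff (by exact_mod_cast h3) (by exact_mod_cast hK)]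
  exact_mod_cast (mul_comm _ _).trans h2

theorem F_swap (n : ℕ) {e : ℤ × ℤ} (he : e ≠ (0, 0)) : F n (pt e.swap) = F n (pt e) := by
  have h : e.swap ≠ (0, 0) := fun h => he (Prod.swap_injective h)
  rw [F, F, f_pt n he, f_pt n h, ← encard_swap n (0, 0) e]
  rfl

theorem F_b_eq (n m : ℕ) : F n (b m) = F n (a m) := by
  rw [← pt_a, ← pt_b]
  exact F_swap n (e := (2 ^ m, 0)) (by simp [Prod.ext_iff])

theorem F_a_self (n : ℕ) : F n (a n) = 1 := by
  rw [← pt_a, F_eq_div (K := 1) (L := 1) (by simp [Prod.ext_iff]) one_ne_zero (by rw [cp])]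
  norm_num

theorem F_succ_a (n : ℕ) : F (n + 1) (a n) = 1 / 2 := by
  rw [← pt_a, F_eq_div (K := 2) (L := 1) (by simp [Prod.ext_iff]) two_ne_zero]
  · norm_num
  · rw [encard_inner_x, cp_succ]
    push_cast
    ring

theorem F_succ_c (n : ℕ) : F (n + 1) (c n) = 0 := by
  rw [← pt_c, F_eq_div (K := 1) (L := 0) (by simp [Prod.ext_iff]) one_ne_zero]
  · norm_num
  · simp [encard_inner_z]

theorem F_inner {m n K L : ℕ} {e : ℤ × ℤ} (he0 : e ≠ (0, 0)) (he : e.1 < 2 ^ (m + 1))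
    (he' : e.2 < 2 ^ (m + 1)) (hK : K ≠ 0) (h : K * cq (m + 1) e = L * cd (m + 1))
    (hn : m + 1 < n) : F n (pt e) = L / (2 * K) := by
  rw [F_eq_div (K := 2 * K) (L := L) he0 (by omega)]
  · push_cast
    rfl
  · push_cast
    exact mul_encard_inner he he' (by omega) h hn

theorem F_a {m n : ℕ} (hm : 0 < m) (hn : m < n) : F n (a m) = 1 / 2 := by
  rcases Nat.lt_or_ge (m + 1) n with h | h
  · rw [← pt_a, F_inner (m := m) (K := 1) (L := 1) _ _ _ one_ne_zero _ h]
    · norm_num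
    · simp [Prod.ext_iff]
    · simp [pow_succ]
    · simp
    · rw [cq_x, cd_succ m hm]
      push_cast
      ring
  · obtain rfl : n = m + 1 := by omega
    exact F_succ_a m

theorem F_a_zero {n : ℕ} (hn : 1 < n) : F n (a 0) = 1 / 3 := by
  rw [← pt_a, F_inner (m := 0) (K := 3) (L := 2) _ _ _ three_ne_zero _ hn]
  · norm_num
  · simp [Prod.ext_iff]
  · simp
  · simp
  · rw [cq_x, cp_zero, cd_zero, cd_one]
    norm_num

theorem F_c {m n : ℕ} (hm : 0 < m) (hn : m + 1 < n) : F n (c m) = 1 := by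
  rw [← pt_c, F_inner (m := m) (K := 1) (L := 2) _ _ _ one_ne_zero _ hn]
  · norm_num
  · simp [Prod.ext_iff]
  · simp [pow_succ]
  · simp [pow_succ]
  · rw [cq_z, cd_succ m hm]
    push_cast
    ring

theorem F_c_zero {n : ℕ} (hn : 1 < n) : F n (c 0) = 2 / 3 := by
  rw [← pt_c, F_inner (m := 0) (K := 3) (L := 4) _ _ _ three_ne_zero _ hn]
  · norm_num
  · simp [Prod.ext_iff]
  · simp
  · simp
  · rw [cq_z, cp_zero, cd_zero, cd_one]
    norm_num

/-- the distribution ratio at the corner vertices. -/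
theorem F_corner_vertices :
    (∀ n : ℕ, F n (a n) = 1 ∧ F n (b n) = 1) ∧
    (∀ n m : ℕ, 0 < m → m < n → F n (a m) = 1 / 2 ∧ F n (b m) = 1 / 2) ∧
    (F 1 (a 0) = 1 / 2 ∧ F 1 (b 0) = 1 / 2) ∧
    (∀ n : ℕ, 1 < n → F n (a 0) = 1 / 3 ∧ F n (b 0) = 1 / 3) ∧
    (∀ n : ℕ, 1 ≤ n → F n (c (n - 1)) = 0) ∧
    (∀ n m : ℕ, 0 < m → m < n - 1 → F n (c m) = 1) ∧
    (∀ n : ℕ, 1 < n → F n (c 0) = 2 / 3) := by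
  simp only [F_b_eq, and_self]
  refine ⟨F_a_self, fun n m hm hn => F_a hm hn, F_succ_a 0, fun n hn => F_a_zero hn,
    fun n hn => ?_, fun n m hm hn => F_c hm (by omega), fun n hn => F_c_zero hn⟩
  obtain ⟨n, rfl⟩ := Nat.exists_eq_add_of_le' hn
  exact F_succ_c n

end SierpinskiGasket
end
end
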